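/- Addition theorem for tameness I: Let A be an essential hyperplane arrangement in V = K^ℓ, let H ∈ A, and set A' = A∖{H}. If A' is tame and both A' and A are locally free along H, then both A and the restricted arrangement A^H (viewed as an arrangement in H ≅ K^{ℓ−1}) are tame. -/

import Mathlib

noncomputable section
open Classical MvPolynomial

/-- `pdLE R n M` : the `R`-module `M` has projective dimension at most `n`. -/
def pdLE (R : Type) [CommRing R] : ℕ → (M : Type) → [AddCommGroup M] → [Module R M] → Prop
  | 0, M, _, _ => Module.Projective R M
  | n + 1, M, _, _ => ∃ (ι : Type) (f : (ι →₀ R) →ₗ[R] M),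
      Function.Surjective f ∧ pdLE R n (LinearMap.ker f)

/-- Projective dimension as an element of `ℕ∞`. -/
def pdim (R : Type) [CommRing R] (M : Type) [AddCommGroup M] [Module R M] : ℕ∞ :=
  sInf {n : ℕ∞ | ∃ k : ℕ, pdLE R k M ∧ n = (k : ℕ∞)}

/-- The coordinate ring `S = K[x_1, …, x_ℓ]`. -/
abbrev PS (K : Type) [Field K] (ℓ : ℕ) : Type := MvPolynomial (Fin ℓ) K

/-- The free `S`-module of polynomial differential forms of all degrees, realized as the
exterior algebra over `S` on the free module `S^ℓ` (with `dx_i` the standard basis). -/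
abbrev ExtF (K : Type) [Field K] (ℓ : ℕ) : Type :=
  ExteriorAlgebra (PS K ℓ) (Fin ℓ → PS K ℓ)

variable {K : Type} [Field K] {ℓ : ℕ}

/-- The module `Ω^p_V` of polynomial differential `p`-forms. -/
def formsP (K : Type) [Field K] (ℓ : ℕ) (p : ℕ) : Submodule (PS K ℓ) (ExtF K ℓ) :=
  (LinearMap.range (ExteriorAlgebra.ι (PS K ℓ) :
      (Fin ℓ → PS K ℓ) →ₗ[PS K ℓ] ExtF K ℓ)) ^ p

/-- The defining linear form `α = ∑ c_i x_i` of the hyperplane with coefficient vector `c`. -/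
def linP (c : Fin ℓ → K) : PS K ℓ := ∑ i, MvPolynomial.C (c i) * MvPolynomial.X i

/-- The constant one-form `dα = ∑ c_i dx_i`. -/
def dP (c : Fin ℓ → K) : ExtF K ℓ :=
  ExteriorAlgebra.ι (PS K ℓ) (fun i => MvPolynomial.C (c i))

/-- A central hyperplane arrangement in `K^ℓ`: a finite set of (pairwise non-proportional,
nonzero) coefficient vectors of defining linear forms, each representing the hyperplane
`{x : ∑ c_i x_i = 0}`. -/
structure Arrangement (K : Type) [Field K] (ℓ : ℕ) : Type where
  hyps : Finset (Fin ℓ → K)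
  ne_zero : ∀ c ∈ hyps, c ≠ 0
  nonprop : ∀ c ∈ hyps, ∀ c' ∈ hyps, c ≠ c' → ∀ t : K, c ≠ t • c'

/-- The polynomial model of the module `Ω^p(A,m)` of logarithmic `p`-forms of the
multiarrangement `(A,m)`; it is `Q(A,m)·Ω^p(A,m)`, i.e. the image of `Ω^p(A,m)` under the
degree-shifting isomorphism given by multiplication with `Q(A,m)`, so that
`η = Q(A,m)·ω` ranges over polynomial `p`-forms with `dα_H ∧ η ∈ α_H^{m(H)} Ω^{p+1}_V`
for all `H ∈ A`. -/
def Omega (A : Arrangement K ℓ) (m : (Fin ℓ → K) → ℕ) (p : ℕ) :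
    Submodule (PS K ℓ) (ExtF K ℓ) :=
  formsP K ℓ p ⊓ ⨅ c ∈ A.hyps,
    Submodule.comap (LinearMap.mulLeft (PS K ℓ) (dP c))
      (Submodule.map (LinearMap.lsmul (PS K ℓ) (ExtF K ℓ) (linP c ^ m c))
        (formsP K ℓ (p + 1)))

/-- Tameness of a multiarrangement: `pd_S Ω^p(A,m) ≤ p` for all `0 ≤ p ≤ ℓ`. -/
def TameM (A : Arrangement K ℓ) (m : (Fin ℓ → K) → ℕ) : Prop :=
  ∀ p : ℕ, p ≤ ℓ → pdLE (PS K ℓ) p (Omega A m p)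

/-- Tameness of a simple arrangement (constant multiplicity `1`). -/
def Tame (A : Arrangement K ℓ) : Prop := TameM A (fun _ => 1)

/-- Freeness of a multiarrangement: `Ω^1(A,m)` is a free `S`-module. -/
def FreeM (A : Arrangement K ℓ) (m : (Fin ℓ → K) → ℕ) : Prop :=
  Module.Free (PS K ℓ) (Omega A m 1)

/-- An arrangement is essential when the intersection of its hyperplanes is `{0}`,
equivalently the defining forms span the dual space. -/
def Essential (A : Arrangement K ℓ) : Prop :=
  Submodule.span K (A.hyps : Set (Fin ℓ → K)) = ⊤

/-- The localization `A_x = {H ∈ A : x ∈ H}` of an arrangement at a point `x`. -/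
def locArr (A : Arrangement K ℓ) (x : Fin ℓ → K) : Arrangement K ℓ where
  hyps := A.hyps.filter (fun c => ∑ i, c i * x i = 0)
  ne_zero := fun c hc => A.ne_zero c (Finset.mem_filter.mp hc).1
  nonprop := fun c hc c' hc' =>
    A.nonprop c (Finset.mem_filter.mp hc).1 c' (Finset.mem_filter.mp hc').1

/-- `(A,m)` is locally free along the hyperplane `{x : ∑ (c0)_i x_i = 0}` :
`(A_x, m_x)` is free for every nonzero point `x` of this hyperplane. -/
def LocallyFreeAlong (A : Arrangement K ℓ) (m : (Fin ℓ → K) → ℕ) (c0 : Fin ℓ → K) : Prop :=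
  ∀ x : Fin ℓ → K, x ≠ 0 → (∑ i, c0 i * x i = 0) → FreeM (locArr A x) m

/-- The deletion `A ∖ {H}`. -/
def delArr (A : Arrangement K ℓ) (c0 : Fin ℓ → K) : Arrangement K ℓ where
  hyps := A.hyps.erase c0
  ne_zero := fun c hc => A.ne_zero c (Finset.mem_of_mem_erase hc)
  nonprop := fun c hc c' hc' =>
    A.nonprop c (Finset.mem_of_mem_erase hc) c' (Finset.mem_of_mem_erase hc')

/-- The coefficient vector of the restriction of the linear form `c` to the hyperplane `H`
along the linear identification `e : K^{ℓ-1} ≃ H`. -/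
def restrictForm (e : (Fin (ℓ - 1) → K) →ₗ[K] (Fin ℓ → K)) (c : Fin ℓ → K) :
    Fin (ℓ - 1) → K := fun i => ∑ j, c j * e (Pi.single i 1) j

/-- The linear form on `K^ℓ` with coefficient vector `c`. -/
def dotLin (c : Fin ℓ → K) : (Fin ℓ → K) →ₗ[K] K := ∑ i, c i • LinearMap.proj i

/-- `e` identifies `K^{ℓ-1}` with the hyperplane `ker(α_{c0})`. -/
def IsHypEmbedding (c0 : Fin ℓ → K) (e : (Fin (ℓ - 1) → K) →ₗ[K] (Fin ℓ → K)) : Prop :=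
  Function.Injective e ∧ LinearMap.range e = LinearMap.ker (dotLin c0)

/-- `B` (an arrangement in `K^{ℓ-1}`) represents the restriction `A^H` of `A` to the
hyperplane `H` determined by `c0 ∈ A`, via the identification `e : K^{ℓ-1} ≃ H`:
its hyperplanes are exactly the restrictions to `H` of the hyperplanes of `A ∖ {H}`. -/
def IsRestrictionOf (B : Arrangement K (ℓ - 1)) (A : Arrangement K ℓ) (c0 : Fin ℓ → K)
    (e : (Fin (ℓ - 1) → K) →ₗ[K] (Fin ℓ → K)) : Prop :=
  (∀ c ∈ A.hyps, c ≠ c0 → ∃ c' ∈ B.hyps, ∃ t : K, t ≠ 0 ∧ restrictForm e c = t • c') ∧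
  (∀ c' ∈ B.hyps, ∃ c ∈ A.hyps, c ≠ c0 ∧ ∃ t : K, t ≠ 0 ∧ restrictForm e c = t • c')
/-- The Ziegler multiplicity `m^H` on the restriction: `m^H(X) = #{L ∈ A∖{H} : L ∩ H = X}`. -/
def zieglerMult (A : Arrangement K ℓ) (c0 : Fin ℓ → K)
    (e : (Fin (ℓ - 1) → K) →ₗ[K] (Fin ℓ → K)) (c' : Fin (ℓ - 1) → K) : ℕ :=
  (A.hyps.filter (fun c => c ≠ c0 ∧ ∃ t : K, t ≠ 0 ∧ restrictForm e c = t • c')).card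

/-- The wedge `dx_{i_1} ∧ ⋯ ∧ dx_{i_p}` for a list of indices. -/
def wedgeList (l : List (Fin ℓ)) : ExtF K ℓ :=
  (l.map (fun i => ExteriorAlgebra.ι (PS K ℓ) (Pi.single i (1 : PS K ℓ)))).prod

/-- A polynomial `p`-form is homogeneous of (coefficient) degree `d` if it is a sum of
terms `f · dx_{i_1} ∧ ⋯ ∧ dx_{i_p}` with `f` homogeneous of degree `d`. -/
def IsHomogForm (p d : ℕ) (η : ExtF K ℓ) : Prop :=
  η ∈ AddSubgroup.closure {ξ : ExtF K ℓ | ∃ (f : PS K ℓ) (l : List (Fin ℓ)),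
    f.IsHomogeneous d ∧ l.length = p ∧ ξ = f • wedgeList l}

/-- `|m| = ∑_{H ∈ A} m(H)`. -/
def msum (A : Arrangement K ℓ) (m : (Fin ℓ → K) → ℕ) : ℕ := ∑ c ∈ A.hyps, m c

/-- The multiarrangement `(A,m)` is free with exponents `(d_1, …, d_ℓ)`: the polynomial
model of `Ω^1(A,m)` has a homogeneous basis whose `i`-th member has coefficient degree
`|m| - d_i`. -/
def FreeWithExp (A : Arrangement K ℓ) (m : (Fin ℓ → K) → ℕ) (d : Fin ℓ → ℕ) : Prop :=
  ∃ b : Fin ℓ → ExtF K ℓ,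
    (∀ i, b i ∈ Omega A m 1) ∧
    (∀ i, IsHomogForm 1 (msum A m - d i) (b i)) ∧
    LinearIndependent (PS K ℓ) b ∧
    Omega A m 1 ≤ Submodule.span (PS K ℓ) (Set.range b)

/-- The exponent vector `(d_1, d_2, 0, …, 0)`. -/
def expVec (d1 d2 : ℕ) : Fin ℓ → ℕ := fun i =>
  if (i : ℕ) = 0 then d1 else if (i : ℕ) = 1 then d2 else 0

/-- The localization `A_X` of `A` at the lattice element `X = H ∩ L` corresponding,
via the identification `e` of `H` with `K^{ℓ-1}`, to the hyperplane of `H`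
with coefficient vector `c'`. -/
def locOnRestr (A : Arrangement K ℓ) (e : (Fin (ℓ - 1) → K) →ₗ[K] (Fin ℓ → K))
    (c' : Fin (ℓ - 1) → K) : Arrangement K ℓ where
  hyps := A.hyps.filter (fun c => ∃ t : K, restrictForm e c = t • c')
  ne_zero := fun c hc => A.ne_zero c (Finset.mem_filter.mp hc).1
  nonprop := fun c hc c'' hc'' =>
    A.nonprop c (Finset.mem_filter.mp hc).1 c'' (Finset.mem_filter.mp hc'').1

/-- The multiplicity `m - δ_H`. -/
def mdel (m : (Fin ℓ → K) → ℕ) (c0 : Fin ℓ → K) : (Fin ℓ → K) → ℕ :=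
  fun c => if c = c0 then m c - 1 else m c

/-- `ms` is the Euler multiplicity `m^*` on the restriction `B = A^H` (presented via the
identification `e`): for each `X ∈ A^H` the rank-two localization `(A_X, m_X)` is free
with exponents `(d_1^X, d_2^X, 0, …, 0)` ordered so that `(A_X, m_X - δ_H)` is free with
exponents `(d_1^X - 1, d_2^X, 0, …, 0)`, and `m^*(X) = d_2^X`. -/
def IsEulerMult (A : Arrangement K ℓ) (m : (Fin ℓ → K) → ℕ) (c0 : Fin ℓ → K)
    (e : (Fin (ℓ - 1) → K) →ₗ[K] (Fin ℓ → K)) (B : Arrangement K (ℓ - 1))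
    (ms : (Fin (ℓ - 1) → K) → ℕ) : Prop :=
  ∀ c' ∈ B.hyps, ∃ d1 d2 : ℕ,
    FreeWithExp (locOnRestr A e c') m (expVec d1 d2) ∧
    FreeWithExp (locOnRestr A e c') (mdel m c0) (expVec (d1 - 1) d2) ∧
    ms c' = d2

/-- An arrangement is generic if any `k ≤ ℓ-1` of its hyperplanes intersect in
codimension `k`, i.e. any `≤ ℓ-1` of its defining forms are linearly independent. -/
def GenericArr (A : Arrangement K ℓ) : Prop :=
  ∀ s : Finset (Fin ℓ → K), s ⊆ A.hyps → s.card ≤ ℓ - 1 →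
    LinearIndependent K (fun x : {c // c ∈ s} => (x : Fin ℓ → K))

/-- An arrangement is irreducible if it is not a product of two lower-dimensional
arrangements, i.e. its defining forms cannot be split into two complementary proper
subspaces of the dual space. -/
def IrreducibleArr (A : Arrangement K ℓ) : Prop :=
  ¬ ∃ U1 U2 : Submodule K (Fin ℓ → K), U1 ≠ ⊥ ∧ U2 ≠ ⊥ ∧ U1 ⊓ U2 = ⊥ ∧ U1 ⊔ U2 = ⊤ ∧
      ∀ c ∈ A.hyps, c ∈ U1 ∨ c ∈ U2

/-- The defining polynomial `Q(A,m) = ∏_{H ∈ A} α_H^{m(H)}`. -/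
def Qpoly (A : Arrangement K ℓ) (m : (Fin ℓ → K) → ℕ) : PS K ℓ :=
  ∏ c ∈ A.hyps, linP c ^ m c

section ProjectiveDimension
open CategoryTheory

lemma pdLE_iff_hasProjectiveDimensionLE {R : Type} [CommRing R] (n : ℕ) (M : Type)
    [AddCommGroup M] [Module R M] :
    pdLE R n M ↔ HasProjectiveDimensionLT (ModuleCat.of R M) (n + 1) := by
  induction n generalizing M with
  | zero =>
    rw [pdLE, IsProjective.iff_projective, zero_add, projective_iff_hasProjectiveDimensionLT_one]
  | succ n ih =>
    have key : ∀ (ι : Type) (f : (ι →₀ R) →ₗ[R] M), Function.Surjective f →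
        (pdLE R n (LinearMap.ker f) ↔ HasProjectiveDimensionLT (ModuleCat.of R M) (n + 2)) := by
      intro ι f hf
      rw [ih]
      exact ((LinearMap.shortExact_shortComplexKer hf).hasProjectiveDimensionLT_X₃_iff n
        ((IsProjective.iff_projective _).mp inferInstance)).symm
    constructor
    · rintro ⟨ι, f, hf, h⟩
      exact (key ι f hf).mp h
    · intro h
      exact ⟨M, Finsupp.linearCombination R (fun m : M => m),
        fun m => ⟨Finsupp.single m 1, by simp⟩,
        (key _ _ (fun m => ⟨Finsupp.single m 1, by simp⟩)).mpr h⟩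

variable {R : Type} [CommRing R] {M N P : Type} [AddCommGroup M] [Module R M]
  [AddCommGroup N] [Module R N] [AddCommGroup P] [Module R P]

lemma pdLE.mono {m n : ℕ} (h : m ≤ n) (hM : pdLE R m M) : pdLE R n M := by
  rw [pdLE_iff_hasProjectiveDimensionLE] at *
  exact hasProjectiveDimensionLT_of_ge _ (m + 1) _ (by omega)

lemma pdLE_of_projective [Module.Projective R M] (n : ℕ) : pdLE R n M :=
  pdLE.mono (m := 0) (Nat.zero_le n) ‹_›

lemma pdLE.of_linearEquiv {n : ℕ} (e : M ≃ₗ[R] N) (hM : pdLE R n M) : pdLE R n N := by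
  rw [pdLE_iff_hasProjectiveDimensionLE] at *
  exact hasProjectiveDimensionLT_of_iso e.toModuleIso _

lemma pdLE.middle {f : M →ₗ[R] N} {g : N →ₗ[R] P} (hf : Function.Injective f)
    (hg : Function.Surjective g) (hfg : Function.Exact f g) {n : ℕ}
    (hM : pdLE R n M) (hP : pdLE R n P) : pdLE R n N := by
  rw [pdLE_iff_hasProjectiveDimensionLE] at *
  exact (ModuleCat.shortComplex_shortExact
    (ModuleCat.shortComplexOfCompEqZero f g hfg.linearMap_comp_eq_zero) hfg
      hf hg).hasProjectiveDimensionLT_X₂ _ hM hP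

lemma pdLE.right {f : M →ₗ[R] N} {g : N →ₗ[R] P} (hf : Function.Injective f)
    (hg : Function.Surjective g) (hfg : Function.Exact f g) {n : ℕ}
    (hM : pdLE R n M) (hN : pdLE R (n + 1) N) : pdLE R (n + 1) P := by
  rw [pdLE_iff_hasProjectiveDimensionLE] at *
  exact (ModuleCat.shortComplex_shortExact
    (ModuleCat.shortComplexOfCompEqZero f g hfg.linearMap_comp_eq_zero) hfg
      hf hg).hasProjectiveDimensionLT_X₃ _ hM hN

lemma pdLE.left {f : M →ₗ[R] N} {g : N →ₗ[R] P} (hf : Function.Injective f)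
    (hg : Function.Surjective g) (hfg : Function.Exact f g) {n : ℕ}
    (hN : pdLE R n N) (hP : pdLE R (n + 1) P) : pdLE R n M := by
  rw [pdLE_iff_hasProjectiveDimensionLE] at *
  exact (ModuleCat.shortComplex_shortExact
    (ModuleCat.shortComplexOfCompEqZero f g hfg.linearMap_comp_eq_zero) hfg
      hf hg).hasProjectiveDimensionLT_X₁ _ hN hP

lemma pdLE.ker {f : M →ₗ[R] N} (hf : Function.Surjective f) {n : ℕ}
    (hM : pdLE R n M) (hN : pdLE R (n + 1) N) : pdLE R n (LinearMap.ker f) :=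
  pdLE.left (f := (LinearMap.ker f).subtype) (g := f) (Subtype.val_injective) hf
    (LinearMap.exact_subtype_ker_map f) hM hN

lemma pdLE.of_ker {f : M →ₗ[R] N} (hf : Function.Surjective f) {n : ℕ}
    (hK : pdLE R n (LinearMap.ker f)) (hM : pdLE R (n + 1) M) : pdLE R (n + 1) N :=
  pdLE.right (f := (LinearMap.ker f).subtype) (g := f) (Subtype.val_injective) hf
    (LinearMap.exact_subtype_ker_map f) hK hM

/-- The kernel of a map between projective modules is a second syzygy. -/
lemma pdLE_ker_of_globalDimension {d : ℕ}
    (hd : ∀ (X : Type) [AddCommGroup X] [Module R X], pdLE R d X)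
    [Module.Projective R M] [Module.Projective R N] (f : M →ₗ[R] N) :
    pdLE R (d - 2) (LinearMap.ker f) := by
  have h1 : pdLE R (d - 1) (LinearMap.range f) := by
    have := pdLE.ker (f := (LinearMap.range f).mkQ) (Submodule.mkQ_surjective _) (n := d - 1)
      (pdLE_of_projective _) ((hd _).mono (by omega))
    rwa [Submodule.ker_mkQ] at this
  have := pdLE.ker (f := f.rangeRestrict) f.surjective_rangeRestrict (n := d - 2)
    (pdLE_of_projective _) (h1.mono (by omega))
  rwa [LinearMap.ker_rangeRestrict] at this

lemma pdLE.of_semilinearEquiv {R' : Type} [CommRing R'] {M' : Type} [AddCommGroup M']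
    [Module R' M'] (e : R ≃+* R') (f : M ≃+ M') (hf : ∀ (r : R) (m : M), f (r • m) = e r • f m)
    {n : ℕ} (h : pdLE R n M) : pdLE R' n M' := by
  rw [pdLE_iff_hasProjectiveDimensionLE] at *
  let := RingHomInvPair.of_ringEquiv e
  let := RingHomInvPair.symm (RingHomClass.toRingHom e) (RingHomClass.toRingHom e.symm)
  let F : M ≃ₛₗ[RingHomClass.toRingHom e] M' := { f with map_smul' := hf }
  exact ModuleCat.hasProjectiveDimensionLE_of_semiLinearEquiv (M := ModuleCat.of R M)
    (N := ModuleCat.of R' M') e F n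

end ProjectiveDimension

section GlobalDimension
open Polynomial TensorProduct PolynomialModule

lemma pdLE.baseChange {R : Type} [CommRing R] (A : Type) [CommRing A] [Algebra R A]
    [Module.Flat R A] {n : ℕ} {M : Type} [AddCommGroup M] [Module R M] (h : pdLE R n M) :
    pdLE A n (A ⊗[R] M) := by
  induction n generalizing M with
  | zero =>
    have : Module.Projective R M := h
    exact (inferInstance : Module.Projective A (A ⊗[R] M))
  | succ n ih =>
    obtain ⟨ι, f, hf, hk⟩ := h
    refine pdLE.right (f := (LinearMap.ker f).subtype.baseChange A) (g := f.baseChange A)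
      ?_ ?_ ?_ (ih hk) (pdLE_of_projective _)
    · exact Module.Flat.lTensor_preserves_injective_linearMap _ Subtype.val_injective
    · exact LinearMap.lTensor_surjective _ hf
    · have hex : Function.Exact (LinearMap.ker f).subtype f := LinearMap.exact_subtype_ker_map f
      exact lTensor_exact (M := LinearMap.ker f) (N := ι →₀ R) A hex hf

variable {R : Type} [CommRing R] {M : Type} [AddCommGroup M] [Module R M] [Module R[X] M]
  [IsScalarTower R R[X] M]

/-- The action map `M[X] → M` of an `R[X]`-module `M`. -/
def polyAction : PolynomialModule R M →ₗ[R[X]] M where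
  toFun y := PolynomialModule.eval (Polynomial.X : R[X])
    (PolynomialModule.map R[X] (LinearMap.id : M →ₗ[R] M) y)
  map_add' x y := by simp
  map_smul' p y := by
    rw [PolynomialModule.map_smul, PolynomialModule.eval_smul]
    congr 1
    rw [Polynomial.algebraMap_eq, Polynomial.eval_map, Polynomial.eval₂_C_X, RingHom.id_apply]

lemma polyAction_single (k : ℕ) (m : M) :
    polyAction (PolynomialModule.single R k m) = (Polynomial.X : R[X]) ^ k • m := by
  simp [polyAction]

/-- The endomorphism `X • y - x y` of `M[X]`, where `x` is the action of `X` on `M`. -/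
def polyDiff : PolynomialModule R M →ₗ[R[X]] PolynomialModule R M where
  toFun y := (Polynomial.X : R[X]) • y -
    PolynomialModule.map R (Module.toModuleEnd R (S := R[X]) M Polynomial.X) y
  map_add' x y := by simp only [smul_add, map_add]; abel
  map_smul' p y := by
    rw [PolynomialModule.map_smul]
    simp [smul_sub, smul_smul, mul_comm]

lemma polyDiff_single (k : ℕ) (m : M) : polyDiff (PolynomialModule.single R k m) =
    PolynomialModule.single R (k + 1) m -
      PolynomialModule.single R k ((Polynomial.X : R[X]) • m) := by
  simp [polyDiff, ← Polynomial.monomial_one_one_eq_X, PolynomialModule.monomial_smul_single,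
    add_comm]

lemma polyDiff_coeff_succ (y : PolynomialModule R M) (k : ℕ) :
    (polyDiff y).coeff (k + 1) = y.coeff k - (Polynomial.X : R[X]) • y.coeff (k + 1) := by
  induction y using PolynomialModule.induction_linear with
  | zero => simp
  | add f g hf hg =>
    simp only [map_add, PolynomialModule.coeff_add, Finsupp.add_apply, hf, hg, smul_add]
    abel
  | single i m =>
    rw [polyDiff_single]
    have h (a b : PolynomialModule R M) : (a - b).coeff = a.coeff - b.coeff := rfl
    rw [h]
    simp only [coeff_single, Finsupp.sub_apply, Finsupp.single_apply]
    by_cases h1 : i = k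
    · subst h1; simp
    · by_cases h2 : i = k + 1
      · subst h2; simp
      · simp [h1, h2]

lemma polyDiff_injective : Function.Injective (polyDiff (R := R) (M := M)) := by
  rw [injective_iff_map_eq_zero]
  intro y hy
  have key : ∀ k, y.coeff k = (Polynomial.X : R[X]) • y.coeff (k + 1) := by
    intro k
    have := polyDiff_coeff_succ y k
    rw [hy] at this
    exact (sub_eq_zero.mp this.symm)
  by_contra hne
  have hs : y.coeff.support.Nonempty := by
    rw [Finsupp.support_nonempty_iff]
    simpa using hne
  have h1 := Finset.max'_mem _ hs
  rw [Finsupp.mem_support_iff] at h1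
  apply h1
  rw [key]
  have : y.coeff (y.coeff.support.max' hs + 1) = 0 := by
    by_contra h2
    have := Finset.le_max' _ _ (Finsupp.mem_support_iff.mpr h2)
    omega
  rw [this, smul_zero]

lemma sub_polyAction_mem_range (y : PolynomialModule R M) :
    y - PolynomialModule.single R 0 (polyAction y) ∈
      LinearMap.range (polyDiff (R := R) (M := M)) := by
  induction y using PolynomialModule.induction_linear with
  | zero => simp
  | add f g hf hg =>
    rw [map_add, PolynomialModule.single_add]
    convert Submodule.add_mem _ hf hg using 1
    abel
  | single i m =>
    rw [polyAction_single]
    induction i generalizing m with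
    | zero => simp
    | succ i ih =>
      have h := Submodule.add_mem _ (ih ((Polynomial.X : R[X]) • m))
        (LinearMap.mem_range_self polyDiff (PolynomialModule.single R i m))
      rw [polyDiff_single, smul_smul, ← pow_succ] at h
      convert h using 1
      abel

lemma polyDiff_exact :
    Function.Exact (polyDiff (R := R) (M := M)) (polyAction (R := R) (M := M)) := by
  intro y
  constructor
  · intro h
    have := sub_polyAction_mem_range y
    rwa [h, PolynomialModule.single_zero, sub_zero] at this
  · rintro ⟨y, rfl⟩
    induction y using PolynomialModule.induction_linear with
    | zero => simp
    | add f g hf hg => rw [map_add, map_add, hf, hg, add_zero]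
    | single i m =>
      rw [polyDiff_single, map_sub, polyAction_single, polyAction_single, smul_smul, ← pow_succ,
        sub_self]

lemma pdLE_polynomial {d : ℕ} (hd : pdLE R d M) : pdLE R[X] (d + 1) M := by
  have h : pdLE R[X] d (PolynomialModule R M) :=
    (hd.baseChange R[X]).of_linearEquiv (polynomialTensorProductLEquivPolynomialModule R M)
  refine pdLE.right (f := polyDiff (R := R) (M := M)) (g := polyAction) polyDiff_injective ?_
    polyDiff_exact h (h.mono (Nat.le_succ _))
  exact fun m => ⟨PolynomialModule.single R 0 m, by simp [polyAction_single]⟩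

/-- Hilbert's syzygy theorem. -/
theorem pdLE_mvPolynomial (K : Type) [Field K] (d : ℕ) (M : Type) [AddCommGroup M]
    [Module (MvPolynomial (Fin d) K) M] : pdLE (MvPolynomial (Fin d) K) d M := by
  induction d generalizing M with
  | zero =>
    let e : K ≃+* MvPolynomial (Fin 0) K := (MvPolynomial.isEmptyRingEquiv K (Fin 0)).symm
    let _ : Module K M := Module.compHom M e.toRingHom
    have h : pdLE K 0 M := pdLE_of_projective 0
    exact h.of_semilinearEquiv e (AddEquiv.refl M) fun _ _ => rfl
  | succ d ih =>
    let e := (MvPolynomial.finSuccEquiv K d).symm.toRingEquiv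
    let _ : Module (MvPolynomial (Fin d) K)[X] M := Module.compHom M e.toRingHom
    let _ : Module (MvPolynomial (Fin d) K) M :=
      Module.compHom M (Polynomial.C : _ →+* (MvPolynomial (Fin d) K)[X])
    have : IsScalarTower (MvPolynomial (Fin d) K) (MvPolynomial (Fin d) K)[X] M :=
      ⟨fun a b m => by
        rw [Polynomial.smul_eq_C_mul, mul_smul]; rfl⟩
    exact (pdLE_polynomial (ih M)).of_semilinearEquiv e (AddEquiv.refl M) fun _ _ => rfl

end GlobalDimension

section ChangeOfRings
open TensorProduct

lemma pdLE.of_retract {R : Type} [CommRing R] {M N : Type} [AddCommGroup M] [Module R M]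
    [AddCommGroup N] [Module R N] (i : N →ₗ[R] M) (r : M →ₗ[R] N)
    (h : r ∘ₗ i = LinearMap.id) {n : ℕ} (hM : pdLE R n M) : pdLE R n N := by
  rw [pdLE_iff_hasProjectiveDimensionLE] at *
  let ret : CategoryTheory.Retract (ModuleCat.of R N) (ModuleCat.of R M) :=
    { i := ModuleCat.ofHom i
      r := ModuleCat.ofHom r
      retract := by rw [← ModuleCat.ofHom_comp, h, ModuleCat.ofHom_id] }
  exact ret.hasProjectiveDimensionLT _

variable {R R' : Type} [CommRing R] [CommRing R'] [Algebra R R'] {a : R}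

lemma exists_smul_of_one_tmul_eq_zero (hsurj : Function.Surjective (algebraMap R R'))
    (hker : ∀ r, algebraMap R R' r = 0 ↔ ∃ s, r = a * s)
    {P : Type} [AddCommGroup P] [Module R P] {x : P} (hx : (1 : R') ⊗ₜ[R] x = 0) :
    ∃ q, x = a • q := by
  have hex : Function.Exact (LinearMap.mulLeft R a) (Algebra.linearMap R R') := by
    intro r
    rw [Algebra.linearMap_apply, hker]
    exact ⟨fun ⟨s, hs⟩ => ⟨s, hs.symm⟩, fun ⟨s, hs⟩ => ⟨s, hs.symm⟩⟩
  have h := rTensor_exact P hex (by exact hsurj)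
  obtain ⟨z, hz⟩ := (h ((1 : R) ⊗ₜ x)).mp (by simpa using hx)
  refine ⟨TensorProduct.lid R P z, ?_⟩
  have h2 : ∀ z : R ⊗[R] P, TensorProduct.lid R P ((LinearMap.mulLeft R a).rTensor P z) =
      a • TensorProduct.lid R P z := by
    intro z
    induction z with
    | zero => simp
    | add x y hx hy => simp only [map_add, hx, hy, smul_add]
    | tmul r p => simp [mul_smul]
  rw [← h2, hz, TensorProduct.lid_tmul, one_smul]

lemma pdLE_one_finsupp (hsurj : Function.Surjective (algebraMap R R'))
    (hker : ∀ r, algebraMap R R' r = 0 ↔ ∃ s, r = a * s) (ha : ∀ r, a * r = 0 → r = 0)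
    (ι : Type) : pdLE R 1 (ι →₀ R') := by
  refine pdLE.right (f := LinearMap.lsmul R (ι →₀ R) a)
    (g := Finsupp.mapRange.linearMap (Algebra.linearMap R R')) ?_ ?_ ?_ (n := 0)
    (pdLE_of_projective 0) (pdLE_of_projective 1)
  · rw [injective_iff_map_eq_zero]
    intro x hx
    ext i
    exact ha _ (by simpa using DFunLike.congr_fun hx i)
  · exact Finsupp.mapRange_surjective _ (by simp) hsurj
  · intro x
    constructor
    · intro h
      have h1 : ∀ i, ∃ s, x i = a * s := fun i => (hker _).mp (by
        simpa using DFunLike.congr_fun h i)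
      choose s hs using h1
      refine ⟨Finsupp.onFinset x.support (fun i => if x i = 0 then 0 else s i) ?_, ?_⟩
      · intro i hi
        rw [Finsupp.mem_support_iff]
        rintro h0
        simp [h0] at hi
      · ext i
        by_cases h0 : x i = 0
        · simp [h0]
        · simp [h0, ← hs]
    · rintro ⟨y, rfl⟩
      ext i
      have h0 : algebraMap R R' a = 0 := (hker a).mpr ⟨1, (mul_one a).symm⟩
      simp [Algebra.smul_def, h0]

variable {N : Type} [AddCommGroup N] [Module R' N] [Module R N] [IsScalarTower R R' N]

lemma pdLE.restrictScalars (hsurj : Function.Surjective (algebraMap R R'))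
    (hker : ∀ r, algebraMap R R' r = 0 ↔ ∃ s, r = a * s) (ha : ∀ r, a * r = 0 → r = 0)
    {p : ℕ} (h : pdLE R' p N) : pdLE R (p + 1) N := by
  induction p generalizing N with
  | zero =>
    obtain ⟨s, hs⟩ := (Module.projective_def' (R := R') (P := N)).mp h
    exact (pdLE_one_finsupp hsurj hker ha N).of_retract (s.restrictScalars R)
      ((Finsupp.linearCombination R' id).restrictScalars R)
      (LinearMap.ext fun n => LinearMap.congr_fun hs n)
  | succ p ih =>
    obtain ⟨ι, f, hf, hk⟩ := h
    exact pdLE.right (f := (LinearMap.ker f).subtype.restrictScalars R)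
      (g := f.restrictScalars R) Subtype.val_injective hf
      (LinearMap.exact_subtype_ker_map f) (ih hk)
      ((pdLE_one_finsupp hsurj hker ha ι).mono (by omega))

lemma exists_eq_one_tmul (hsurj : Function.Surjective (algebraMap R R'))
    {P : Type} [AddCommMonoid P] [Module R P] (x : R' ⊗[R] P) : ∃ p : P, x = 1 ⊗ₜ p := by
  induction x with
  | zero => exact ⟨0, by simp⟩
  | add x y hx hy =>
    obtain ⟨p, rfl⟩ := hx
    obtain ⟨q, rfl⟩ := hy
    exact ⟨p + q, by rw [tmul_add]⟩
  | tmul r p =>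
    obtain ⟨s, rfl⟩ := hsurj r
    exact ⟨s • p, by rw [tmul_smul, smul_tmul', Algebra.smul_def, mul_one]⟩

lemma pdLE.of_ker_eq (hsurj : Function.Surjective (algebraMap R R'))
    {F W : Type} [AddCommGroup F] [Module R F] [AddCommGroup W] [Module R' W] [Module R W]
    [IsScalarTower R R' W] (ψ : F →ₗ[R] W) (f : F →ₗ[R] N) (hψ : Function.Surjective ψ)
    (hf : Function.Surjective f) (hk : LinearMap.ker ψ = LinearMap.ker f) {m : ℕ}
    (h : pdLE R' m W) : pdLE R' m N := by
  let e : W ≃ₗ[R] N :=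
    (ψ.quotKerEquivOfSurjective hψ).symm ≪≫ₗ
      Submodule.quotEquivOfEq _ _ hk ≪≫ₗ f.quotKerEquivOfSurjective hf
  refine h.of_semilinearEquiv (RingEquiv.refl R') e.toAddEquiv ?_
  intro r x
  obtain ⟨s, rfl⟩ := hsurj r
  have h1 := e.map_smul s x
  rw [← algebraMap_smul R' s (e x)] at h1
  rw [← algebraMap_smul R' s x] at h1
  exact h1

lemma pdLE_pred_of_presentation (hsurj : Function.Surjective (algebraMap R R'))
    (hker : ∀ r, algebraMap R R' r = 0 ↔ ∃ s, r = a * s)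
    {L F : Type} [AddCommGroup L] [Module R L] [AddCommGroup F] [Module R F]
    (k : L →ₗ[R] F) (f : F →ₗ[R] N) (hk : Function.Injective k) (hf : Function.Surjective f)
    (hkf : Function.Exact k f) [Module.Projective R L] [Module.Projective R F]
    (haF : ∀ x : F, a • x = 0 → x = 0) {m : ℕ} (hm : pdLE R' (m + 1) N) : pdLE R' m N := by
  have ha0 : algebraMap R R' a = 0 := (hker a).mpr ⟨1, (mul_one a).symm⟩
  have hann : ∀ n : N, a • n = 0 := fun n => by
    rw [← algebraMap_smul R' a n, ha0, zero_smul]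
  have hannT : ∀ (P : Type) [AddCommGroup P] [Module R P] (x : P),
      (1 : R') ⊗ₜ[R] (a • x) = 0 := fun P _ _ x => by
    rw [tmul_smul, smul_tmul', Algebra.smul_def, ha0, zero_mul, zero_tmul]
  obtain ⟨g, hg1⟩ : ∃ g : R' ⊗[R] F →ₗ[R'] N, ∀ x, g (1 ⊗ₜ x) = f x :=
    ⟨LinearMap.liftBaseChange R' f, fun x => by simp⟩
  have hg : Function.Surjective g := fun n => by
    obtain ⟨x, rfl⟩ := hf n
    exact ⟨1 ⊗ₜ x, hg1 x⟩
  obtain ⟨i, hi1⟩ : ∃ i : R' ⊗[R] L →ₗ[R'] R' ⊗[R] F, ∀ x, i (1 ⊗ₜ x) = 1 ⊗ₜ k x :=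
    ⟨k.baseChange R', fun x => by simp⟩
  have hig : ∀ x, i x ∈ LinearMap.ker g := by
    intro x
    obtain ⟨l, rfl⟩ := exists_eq_one_tmul hsurj x
    rw [hi1, LinearMap.mem_ker, hg1]
    exact hkf.apply_apply_eq_zero l
  obtain ⟨j, hj1⟩ : ∃ j : R' ⊗[R] L →ₗ[R'] LinearMap.ker g, ∀ x, (j x : R' ⊗[R] F) = i x :=
    ⟨i.codRestrict _ hig, fun x => rfl⟩
  have hj : Function.Surjective j := by
    rintro ⟨x, hx⟩
    obtain ⟨y, rfl⟩ := exists_eq_one_tmul hsurj x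
    rw [LinearMap.mem_ker, hg1] at hx
    obtain ⟨l, rfl⟩ := (hkf y).mp hx
    exact ⟨1 ⊗ₜ l, Subtype.ext ((hj1 _).trans (hi1 _))⟩
  have hJ : pdLE R' m (LinearMap.ker g) := pdLE.ker hg (pdLE_of_projective _) hm
  have hW : pdLE R' m (LinearMap.ker j) :=
    pdLE.ker (M := R' ⊗[R] L) (N := LinearMap.ker g) hj (pdLE_of_projective _)
      (hJ.mono (Nat.le_succ _))
  have hran : ∀ x, a • x ∈ LinearMap.range k := fun x =>
    (hkf _).mp (by rw [map_smul, hann])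
  obtain ⟨af, hafc⟩ : ∃ af : F →ₗ[R] L, ∀ x, k (af x) = a • x :=
    ⟨(LinearEquiv.ofInjective k hk).symm.toLinearMap ∘ₗ
      (LinearMap.lsmul R F a).codRestrict _ hran, fun x =>
      LinearEquiv.ofInjective_symm_apply (h := hk) k ⟨a • x, hran x⟩⟩
  obtain ⟨ψ₀, hψ₀⟩ : ∃ ψ₀ : F →ₗ[R] R' ⊗[R] L, ∀ x, ψ₀ x = 1 ⊗ₜ af x :=
    ⟨(TensorProduct.mk R R' L 1) ∘ₗ af, fun x => rfl⟩
  have hmem : ∀ x, ψ₀ x ∈ (LinearMap.ker j).restrictScalars R := by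
    intro x
    refine Subtype.ext ?_
    rw [hj1, hψ₀, hi1, hafc]
    exact hannT _ _
  refine pdLE.of_ker_eq hsurj (W := (LinearMap.ker j).restrictScalars R)
    (ψ₀.codRestrict _ hmem) f ?_ hf ?_ hW
  · rintro ⟨x, hx⟩
    obtain ⟨l, rfl⟩ := exists_eq_one_tmul hsurj x
    have h0 : (1 : R') ⊗ₜ[R] k l = 0 := by
      rw [← hi1, ← hj1]
      exact congrArg Subtype.val hx
    obtain ⟨q, hq⟩ := exists_smul_of_one_tmul_eq_zero hsurj hker h0
    refine ⟨q, Subtype.ext ?_⟩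
    have hql : af q = l := hk ((hafc q).trans hq.symm)
    exact (hψ₀ q).trans (by rw [hql])
  · rw [LinearMap.ker_codRestrict]
    ext x
    rw [LinearMap.mem_ker, LinearMap.mem_ker, hψ₀]
    constructor
    · intro h0
      obtain ⟨q, hq⟩ := exists_smul_of_one_tmul_eq_zero hsurj hker h0
      have h2 : x = k q := by
        refine sub_eq_zero.mp (haF _ ?_)
        rw [smul_sub, ← hafc, hq, map_smul, sub_self]
      rw [h2]
      exact hkf.apply_apply_eq_zero q
    · intro hx
      obtain ⟨l, rfl⟩ := (hkf x).mp hx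
      have : af (k l) = a • l := hk (by rw [hafc, map_smul])
      rw [this]
      exact hannT _ _

lemma pdLE_pred_of_pdLE_one (hsurj : Function.Surjective (algebraMap R R'))
    (hker : ∀ r, algebraMap R R' r = 0 ↔ ∃ s, r = a * s) (ha : ∀ r, a * r = 0 → r = 0)
    (h : pdLE R 1 N) {m : ℕ} (hm : pdLE R' (m + 1) N) : pdLE R' m N := by
  obtain ⟨ι, f, hf, hK⟩ := h
  have hK' : Module.Projective R (LinearMap.ker f) := hK
  refine pdLE_pred_of_presentation (L := LinearMap.ker f) (F := ι →₀ R) hsurj hker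
    (LinearMap.ker f).subtype f Subtype.val_injective
    hf (LinearMap.exact_subtype_ker_map f) (fun x hx => ?_) hm
  ext s
  exact ha _ (DFunLike.congr_fun hx s)

/-- Change of rings for the projective dimension along `R → R ⧸ (a)`. -/
theorem pdLE_quotient (hsurj : Function.Surjective (algebraMap R R'))
    (hker : ∀ r, algebraMap R R' r = 0 ↔ ∃ s, r = a * s) (ha : ∀ r, a * r = 0 → r = 0)
    {d : ℕ} (hd : ∀ (X : Type) [AddCommGroup X] [Module R' X], pdLE R' d X)
    {p : ℕ} (h : pdLE R (p + 1) N) : pdLE R' p N := by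
  induction p generalizing N with
  | zero =>
    have key : ∀ m, pdLE R' m N → pdLE R' 0 N := by
      intro m
      induction m with
      | zero => exact id
      | succ m ih => exact fun hm => ih (pdLE_pred_of_pdLE_one hsurj hker ha h hm)
    exact key d (hd N)
  | succ p ih =>
    let f : (N →₀ R') →ₗ[R'] N := Finsupp.linearCombination R' id
    have hf : Function.Surjective f := fun n => ⟨Finsupp.single n 1, by simp [f]⟩
    have hk : pdLE R (p + 1) (LinearMap.ker f) :=
      pdLE.left (f := (LinearMap.ker f).subtype.restrictScalars R)
        (g := f.restrictScalars R) Subtype.val_injective hf (LinearMap.exact_subtype_ker_map f)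
        ((pdLE_one_finsupp hsurj hker ha N).mono (by omega)) h
    exact ⟨N, f, hf, ih hk⟩

end ChangeOfRings

section Depth
open CategoryTheory Abelian RingTheory.Sequence

lemma isWeaklyRegular_map_X {σ K : Type} [Field K] {L : List σ} (hL : L.Nodup) :
    IsWeaklyRegular (MvPolynomial σ K) (L.map (X : σ → MvPolynomial σ K)) := by
  rw [isWeaklyRegular_iff_Fin]
  intro i
  have hi : (i : ℕ) < L.length := by simpa using i.2
  have hofList : (Ideal.ofList ((L.map (X : σ → MvPolynomial σ K)).take i) •
      ⊤ : Submodule (MvPolynomial σ K) (MvPolynomial σ K)) =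
      Ideal.span (X '' {j | j ∈ L.take i}) := by
    rw [smul_eq_mul, Ideal.mul_top, ← List.map_take, Ideal.ofList]
    congr 1
    ext y
    simp only [List.mem_map, Set.mem_image, Set.mem_ofPred_eq]
  rw [isSMulRegular_iff_right_eq_zero_of_smul]
  intro q
  induction q using Submodule.Quotient.induction_on with
  | H f =>
    rw [← Submodule.Quotient.mk_smul, Submodule.Quotient.mk_eq_zero,
      Submodule.Quotient.mk_eq_zero, hofList, mem_ideal_span_X_image, mem_ideal_span_X_image]
    intro h m hm
    have hget : (L.map (X : σ → MvPolynomial σ K))[i] = X (L[(i : ℕ)]'hi) := by simp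
    have hm' : m + Finsupp.single (L[(i : ℕ)]'hi) 1 ∈
        ((L.map (X : σ → MvPolynomial σ K))[i] • f).support := by
      rw [hget, smul_eq_mul, mem_support_iff, mul_comm, coeff_mul_X]
      exact mem_support_iff.mp hm
    obtain ⟨j, hj, hne⟩ := h _ hm'
    refine ⟨j, hj, ?_⟩
    have hji : L[(i : ℕ)]'hi ≠ j := by
      rintro rfl
      have hj' : L[(i : ℕ)]'hi ∈ L.take i := hj
      rw [List.mem_take_iff_getElem] at hj'
      obtain ⟨k, hk, hkk⟩ := hj'
      have := (hL.getElem_inj_iff).mp hkk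
      omega
    simpa [Finsupp.single_apply, hji] using hne

variable {R : Type} [CommRing R]

lemma subsingleton_ext_of_isWeaklyRegular (C : ModuleCat.{0} R) (rs : List R) (M : ModuleCat.{0} R)
    (reg : IsWeaklyRegular M rs) (hC : ∀ r ∈ rs, ∃ k : ℕ, r ^ k ∈ Module.annihilator R C) :
    ∀ i < rs.length, Subsingleton (Ext C M i) := by
  induction rs generalizing M with
  | nil => simp
  | cons a rs ih =>
    intro i hi
    rw [isWeaklyRegular_cons_iff] at reg
    obtain ⟨k, hk⟩ := hC a List.mem_cons_self
    match i with
    | 0 =>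
      have : Subsingleton (C →ₗ[R] M) := by
        refine subsingleton_of_forall_eq 0 fun f => LinearMap.ext fun x => ?_
        refine (isSMulRegular_iff_right_eq_zero_of_smul.mp (reg.1.pow k)) _ ?_
        rw [← map_smul, Module.mem_annihilator.mp hk, map_zero]
      exact (Ext.addEquiv₀.trans ModuleCat.homAddEquiv).subsingleton
    | i + 1 =>
      let g := AddCommGrpCat.ofHom ((Ext.mk₀ (ModuleCat.smulShortComplex M a).f).postcomp C
        (add_zero (i + 1)))
      have mono_g : Mono g := by
        apply (Ext.covariant_sequence_exact₁' C reg.1.smulShortComplex_shortExact i (i + 1)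
          rfl).mono_g ((AddCommGrpCat.isZero_of_iff_subsingleton.mpr ?_).eq_zero_of_src _)
        exact ih (ModuleCat.of R (QuotSMulTop a M)) reg.2
          (fun r hr => hC r (List.mem_cons_of_mem _ hr)) i (by simpa using hi)
      let gk := AddCommGrpCat.ofHom ((Ext.mk₀ (M.smulShortComplex (a ^ k)).f).postcomp C
        (add_zero (i + 1)))
      have mono_gk : Mono gk := by
        simp only [ModuleCat.smulShortComplex_f_eq_smul_id, g, gk] at mono_g ⊢
        exact (Ext.postcomp_smul_id_mono_iff (a ^ k) (i + 1)).mpr <|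
          ((Ext.postcomp_smul_id_mono_iff a (i + 1)).mp mono_g).pow k
      have zero_gk : gk = 0 := Ext.postcomp_smul_id_eq_zero_of_mem_annihilator hk (i + 1)
      exact AddCommGrpCat.subsingleton_of_isZero (Limits.IsZero.of_mono_eq_zero _ zero_gk)

lemma subsingleton_ext_of_pdLE (C : ModuleCat.{0} R) {d : ℕ}
    (hF : ∀ (F : Type) [AddCommGroup F] [Module R F], Module.Projective R F →
      ∀ i < d, Subsingleton (Ext C (ModuleCat.of R F) i))
    {q : ℕ} {P : Type} [AddCommGroup P] [Module R P] (hP : pdLE R q P) :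
    ∀ i, i + q < d → Subsingleton (Ext C (ModuleCat.of R P) i) := by
  induction q generalizing P with
  | zero => exact fun i hi => hF P hP i (by omega)
  | succ q ih =>
    obtain ⟨ι, f, hf, hk⟩ := hP
    intro i hi
    have h1 := ih hk (i + 1) (by omega)
    have h2 := hF (ι →₀ R) inferInstance i (by omega)
    refine subsingleton_of_forall_eq 0 fun x => ?_
    obtain ⟨y, hy⟩ := Ext.covariant_sequence_exact₃ C (LinearMap.shortExact_shortComplexKer hf) x
      (n₁ := i + 1) rfl (h1.elim _ _)
    rw [← hy, h2.elim y 0, Ext.zero_comp]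

/-- A map to a torsion-free module with cokernel supported at the origin is surjective, as soon
as its source and its kernel have large depth. -/
theorem surjective_of_pdLE {K : Type} [Field K] {d : ℕ} {P M N : Type} [AddCommGroup P]
    [AddCommGroup M] [AddCommGroup N] [Module (MvPolynomial (Fin d) K) P]
    [Module (MvPolynomial (Fin d) K) M] [Module (MvPolynomial (Fin d) K) N]
    (f : P →ₗ[MvPolynomial (Fin d) K] M) (g : M →ₗ[MvPolynomial (Fin d) K] N)
    (hf : Function.Injective f) (hfg : Function.Exact f g) {q : ℕ} (hq : q + 3 ≤ d)
    (hP : pdLE (MvPolynomial (Fin d) K) q P) (hM : pdLE (MvPolynomial (Fin d) K) (d - 2) M)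
    (hN : ∃ j, IsSMulRegular N (X j : MvPolynomial (Fin d) K))
    (hC : ∀ j, ∃ k : ℕ, ∀ n : N, (X j : MvPolynomial (Fin d) K) ^ k • n ∈ LinearMap.range g) :
    Function.Surjective g := by
  let C := ModuleCat.of (MvPolynomial (Fin d) K) (N ⧸ LinearMap.range g)
  have hann : ∀ j, ∃ k : ℕ,
      (X j : MvPolynomial (Fin d) K) ^ k ∈ Module.annihilator (MvPolynomial (Fin d) K) C := by
    intro j
    obtain ⟨k, hk⟩ := hC j
    refine ⟨k, Module.mem_annihilator.mpr fun c => ?_⟩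
    induction c using Submodule.Quotient.induction_on with
    | H n =>
      exact (Submodule.Quotient.mk_eq_zero _).mpr (hk n)
  have hproj : ∀ (F : Type) [AddCommGroup F] [Module (MvPolynomial (Fin d) K) F],
      Module.Projective (MvPolynomial (Fin d) K) F →
      ∀ i < d, Subsingleton (Ext C (ModuleCat.of (MvPolynomial (Fin d) K) F) i) := by
    intro F _ _ _ i hi
    have hreg := (isWeaklyRegular_map_X (K := K)
      (List.nodup_finRange d)).isWeaklyRegular_lTensor (M₂ := F)
    rw [(TensorProduct.rid _ F).isWeaklyRegular_congr] at hreg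
    refine subsingleton_ext_of_isWeaklyRegular C _ _ hreg ?_ i (by simpa using hi)
    intro r hr
    obtain ⟨j, -, rfl⟩ := List.mem_map.mp hr
    exact hann j
  have hP2 := subsingleton_ext_of_pdLE C hproj hP 2 (by omega)
  have hM1 := subsingleton_ext_of_pdLE C hproj hM 1 (by omega)
  have hN0 : Subsingleton (Ext C (ModuleCat.of (MvPolynomial (Fin d) K) N) 0) := by
    obtain ⟨j, hj⟩ := hN
    refine subsingleton_ext_of_isWeaklyRegular C [X j] _ ?_ ?_ 0 (by simp)
    · rw [isWeaklyRegular_cons_iff]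
      exact ⟨hj, IsWeaklyRegular.nil _ _⟩
    · intro r hr
      rw [List.mem_singleton.mp hr]
      exact hann j
  have hfg' : Function.Exact f g.rangeRestrict := by
    intro x
    rw [← hfg x, Subtype.ext_iff]
    rfl
  have hS1 := ModuleCat.shortComplex_shortExact
    (ModuleCat.shortComplexOfCompEqZero f g.rangeRestrict hfg'.linearMap_comp_eq_zero) hfg' hf
    g.surjective_rangeRestrict
  have hI1 : Subsingleton (Ext C (ModuleCat.of (MvPolynomial (Fin d) K) (LinearMap.range g)) 1) := by
    refine subsingleton_of_forall_eq 0 fun x => ?_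
    obtain ⟨y, hy⟩ := Ext.covariant_sequence_exact₃ C hS1 x (n₁ := 2) rfl (hP2.elim _ _)
    rw [← hy, hM1.elim y 0, Ext.zero_comp]
  have hex : Function.Exact (LinearMap.range g).subtype (LinearMap.range g).mkQ := by
    intro x
    simp
  have hS2 := ModuleCat.shortComplex_shortExact
    (ModuleCat.shortComplexOfCompEqZero (LinearMap.range g).subtype (LinearMap.range g).mkQ
      hex.linearMap_comp_eq_zero) hex Subtype.val_injective (Submodule.mkQ_surjective _)
  obtain ⟨y, hy⟩ := Ext.covariant_sequence_exact₃ C hS2 (Ext.mk₀ (𝟙 C)) (n₁ := 1) rfl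
    (hI1.elim _ _)
  rw [hN0.elim y 0, Ext.zero_comp] at hy
  have hid : 𝟙 C = 0 := by
    apply Ext.homEquiv₀.symm.injective
    simp only [Ext.homEquiv₀_symm_apply, Ext.mk₀_zero]
    exact hy.symm
  intro n
  have h0 : (LinearMap.range g).mkQ n = 0 :=
    LinearMap.congr_fun (ModuleCat.hom_ext_iff.mp hid) ((LinearMap.range g).mkQ n)
  rwa [Submodule.mkQ_apply, Submodule.Quotient.mk_eq_zero] at h0

end Depth

section ExteriorMap
variable {R R' M M' : Type} [CommRing R] [CommRing R'] [AddCommGroup M] [AddCommGroup M']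
  [Module R M] [Module R' M'] (φ : R →+* R')

/-- The ring homomorphism of exterior algebras induced by a semilinear map. -/
def extMap (f : M →ₛₗ[φ] M') : ExteriorAlgebra R M →+* ExteriorAlgebra R' M' :=
  letI : Algebra R (ExteriorAlgebra R' M') :=
    ((algebraMap R' (ExteriorAlgebra R' M')).comp φ).toAlgebra'
      fun r x => Algebra.commutes (φ r) x
  (ExteriorAlgebra.lift R ⟨
    { toFun := fun m => ExteriorAlgebra.ι R' (f m)
      map_add' := fun x y => by rw [map_add, map_add]
      map_smul' := fun r x => by
        rw [map_smulₛₗ, map_smul, Algebra.smul_def, RingHom.id_apply, Algebra.smul_def]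
        rfl },
    fun m => ExteriorAlgebra.ι_sq_zero _⟩ :
      ExteriorAlgebra R M →ₐ[R] ExteriorAlgebra R' M').toRingHom

@[simp] lemma extMap_algebraMap (f : M →ₛₗ[φ] M') (r : R) :
    extMap φ f (algebraMap R _ r) = algebraMap R' _ (φ r) := by
  let : Algebra R (ExteriorAlgebra R' M') :=
    ((algebraMap R' (ExteriorAlgebra R' M')).comp φ).toAlgebra'
      fun r x => Algebra.commutes (φ r) x
  exact AlgHom.commutes (ExteriorAlgebra.lift R _ :
      ExteriorAlgebra R M →ₐ[R] ExteriorAlgebra R' M') r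

@[simp] lemma extMap_ι (f : M →ₛₗ[φ] M') (m : M) :
    extMap φ f (ExteriorAlgebra.ι R m) = ExteriorAlgebra.ι R' (f m) := by
  let : Algebra R (ExteriorAlgebra R' M') :=
    ((algebraMap R' (ExteriorAlgebra R' M')).comp φ).toAlgebra'
      fun r x => Algebra.commutes (φ r) x
  exact ExteriorAlgebra.lift_ι_apply R (A := ExteriorAlgebra R' M') _ _ m

@[simp] lemma extMap_smul (f : M →ₛₗ[φ] M') (r : R) (x : ExteriorAlgebra R M) :
    extMap φ f (r • x) = φ r • extMap φ f x := by
  rw [Algebra.smul_def, map_mul, extMap_algebraMap, ← Algebra.smul_def]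

/-- Interior multiplication by a functional on the exterior algebra. -/
def ctr (d : Module.Dual R M) : ExteriorAlgebra R M →ₗ[R] ExteriorAlgebra R M :=
  CliffordAlgebra.contractLeft d

@[simp] lemma ctr_ι_mul (d : Module.Dual R M) (a : M) (x : ExteriorAlgebra R M) :
    ctr d (ExteriorAlgebra.ι R a * x) = d a • x - ExteriorAlgebra.ι R a * ctr d x :=
  CliffordAlgebra.contractLeft_ι_mul (Q := 0) (d := d) a x

@[simp] lemma ctr_algebraMap (d : Module.Dual R M) (r : R) :
    ctr d (algebraMap R (ExteriorAlgebra R M) r) = 0 :=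
  CliffordAlgebra.contractLeft_algebraMap (Q := 0) (d := d) r

@[simp] lemma ctr_ι (d : Module.Dual R M) (a : M) :
    ctr d (ExteriorAlgebra.ι R a) = algebraMap R _ (d a) :=
  CliffordAlgebra.contractLeft_ι (Q := 0) (d := d) a

lemma ext_induction {P : ExteriorAlgebra R M → Prop}
    (algebraMap : ∀ r : R, P (algebraMap R _ r)) (add : ∀ x y, P x → P y → P (x + y))
    (ι_mul : ∀ m x, P x → P (ExteriorAlgebra.ι R m * x)) (x) : P x :=
  CliffordAlgebra.left_induction (Q := (0 : QuadraticForm R M)) algebraMap add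
    (fun x m h => ι_mul m x h) x

lemma extMap_ctr (f : M →ₛₗ[φ] M') (d : Module.Dual R M) (d' : Module.Dual R' M')
    (h : ∀ m, φ (d m) = d' (f m)) (x : ExteriorAlgebra R M) :
    extMap φ f (ctr d x) = ctr d' (extMap φ f x) := by
  induction x using ext_induction with
  | algebraMap r => simp
  | add x y hx hy => simp only [map_add, hx, hy]
  | ι_mul m x hx => simp [h, hx]

/-- The `p`-th exterior power as a submodule of the exterior algebra. -/
abbrev extP (R M : Type) [CommRing R] [AddCommGroup M] [Module R M] (p : ℕ) :
    Submodule R (ExteriorAlgebra R M) :=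
  (LinearMap.range (ExteriorAlgebra.ι R : M →ₗ[R] ExteriorAlgebra R M)) ^ p

lemma extP_induction {p : ℕ} {P : ExteriorAlgebra R M → Prop}
    (add : ∀ x y, P x → P y → P (x + y))
    (ι_mul : ∀ m, ∀ x ∈ extP R M p, P (ExteriorAlgebra.ι R m * x)) {x : ExteriorAlgebra R M}
    (hx : x ∈ extP R M (p + 1)) : P x := by
  rw [extP, pow_succ'] at hx
  refine Submodule.mul_induction_on hx ?_ add
  rintro _ ⟨m, rfl⟩ b hb
  exact ι_mul m b hb

lemma mem_extP_zero {x : ExteriorAlgebra R M} :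
    x ∈ extP R M 0 ↔ ∃ r, algebraMap R _ r = x := by
  rw [extP, pow_zero, Submodule.mem_one]

lemma mul_mem_extP {p q : ℕ} {x y : ExteriorAlgebra R M} (hx : x ∈ extP R M p)
    (hy : y ∈ extP R M q) : x * y ∈ extP R M (p + q) := by
  rw [extP, pow_add]
  exact Submodule.mul_mem_mul hx hy

lemma ι_mem_extP (m : M) : ExteriorAlgebra.ι R m ∈ extP R M 1 := by
  rw [extP, pow_one]
  exact ⟨m, rfl⟩

lemma ι_mul_mem_extP {p : ℕ} (m : M) {x : ExteriorAlgebra R M} (hx : x ∈ extP R M p) :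
    ExteriorAlgebra.ι R m * x ∈ extP R M (p + 1) := by
  rw [add_comm]
  exact mul_mem_extP (ι_mem_extP m) hx

lemma ctr_mem_extP (d : Module.Dual R M) {p : ℕ} {x : ExteriorAlgebra R M}
    (hx : x ∈ extP R M (p + 1)) : ctr d x ∈ extP R M p := by
  induction p generalizing x with
  | zero =>
    refine extP_induction (P := fun x => ctr d x ∈ extP R M 0)
      (fun x y hx hy => ?_) (fun m x hx => ?_) hx
    · rw [map_add]
      exact add_mem hx hy
    · obtain ⟨r, rfl⟩ := mem_extP_zero.mp hx
      rw [ctr_ι_mul, ctr_algebraMap, mul_zero, sub_zero]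
      exact Submodule.smul_mem _ _ hx
  | succ p ih =>
    refine extP_induction (P := fun x => ctr d x ∈ extP R M (p + 1))
      (fun x y hx hy => ?_) (fun m x hx => ?_) hx
    · rw [map_add]
      exact add_mem hx hy
    · rw [ctr_ι_mul]
      exact sub_mem (Submodule.smul_mem _ _ hx) (ι_mul_mem_extP m (ih hx))

lemma extMap_mem_extP (f : M →ₛₗ[φ] M') {p : ℕ} {x : ExteriorAlgebra R M}
    (hx : x ∈ extP R M p) : extMap φ f x ∈ extP R' M' p := by
  induction p generalizing x with
  | zero =>
    obtain ⟨r, rfl⟩ := mem_extP_zero.mp hx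
    rw [extMap_algebraMap]
    exact mem_extP_zero.mpr ⟨_, rfl⟩
  | succ p ih =>
    refine extP_induction (P := fun x => extMap φ f x ∈ extP R' M' (p + 1))
      (fun x y hx hy => ?_) (fun m x hx => ?_) hx
    · rw [map_add]
      exact add_mem hx hy
    · rw [map_mul, extMap_ι]
      exact ι_mul_mem_extP _ (ih hx)

lemma ι_mul_swap (a b : M) (x : ExteriorAlgebra R M) :
    ExteriorAlgebra.ι R a * (ExteriorAlgebra.ι R b * x) =
      -(ExteriorAlgebra.ι R b * (ExteriorAlgebra.ι R a * x)) := by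
  rw [← mul_assoc, ← mul_assoc, ← neg_mul]
  congr 1
  exact eq_neg_of_add_eq_zero_left (ExteriorAlgebra.ι_add_mul_swap a b)

lemma ι_mul_self_mul (a : M) (x : ExteriorAlgebra R M) :
    ExteriorAlgebra.ι R a * (ExteriorAlgebra.ι R a * x) = 0 := by
  rw [← mul_assoc, ExteriorAlgebra.ι_sq_zero, zero_mul]

/-- In an exterior algebra, a one-form either commutes or anticommutes past a `p`-form. -/
lemma mul_ι_mul_of_mem_extP {p : ℕ} {x : ExteriorAlgebra R M} (hx : x ∈ extP R M p) (a : M)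
    (y : ExteriorAlgebra R M) :
    x * (ExteriorAlgebra.ι R a * y) = (-1 : R) ^ p • (ExteriorAlgebra.ι R a * (x * y)) := by
  induction p generalizing x with
  | zero =>
    obtain ⟨r, rfl⟩ := mem_extP_zero.mp hx
    simp [← Algebra.smul_def]
  | succ p ih =>
    refine extP_induction (P := fun x => x * (ExteriorAlgebra.ι R a * y) =
      (-1 : R) ^ (p + 1) • (ExteriorAlgebra.ι R a * (x * y))) (fun x z hx hz => ?_) (fun m x hx => ?_) hx
    · rw [add_mul, hx, hz, add_mul, mul_add, smul_add]
    · rw [mul_assoc, ih hx, mul_smul_comm, ι_mul_swap, pow_succ, mul_smul, neg_one_smul,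
        mul_assoc]

end ExteriorMap

section FreeExterior
variable {R M : Type} [CommRing R] [AddCommGroup M] [Module R M]

lemma free_exteriorAlgebra [Module.Free R M] : Module.Free R (ExteriorAlgebra R M) := by
  have ⟨I, b⟩ := Module.Free.exists_basis R M
  let : LinearOrder I := linearOrderOfSTO WellOrderingRel
  exact Module.Free.of_basis b.ExteriorAlgebra

lemma isTorsionFree_exteriorAlgebra [IsDomain R] [Module.Free R M] :
    Module.IsTorsionFree R (ExteriorAlgebra R M) := by
  have := free_exteriorAlgebra (R := R) (M := M)
  infer_instance

lemma mem_extP_of_smul_mem [IsDomain R] [Module.Free R M] {f : R} (hf : f ≠ 0) {p : ℕ}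
    {x : ExteriorAlgebra R M} (hx : f • x ∈ extP R M p) : x ∈ extP R M p := by
  have := isTorsionFree_exteriorAlgebra (R := R) (M := M)
  have h1 : GradedAlgebra.proj (fun i : ℕ => ⋀[R]^i M) p (f • x) = f • x := by
    rw [GradedAlgebra.proj_apply, DirectSum.decompose_of_mem_same (fun i : ℕ => ⋀[R]^i M) hx]
  rw [map_smul] at h1
  have h2 := smul_right_injective (ExteriorAlgebra R M) hf h1
  rw [← h2, GradedAlgebra.proj_apply]
  exact SetLike.coe_mem _

lemma exists_smul_iff_dvd [Module.Free R M] : ∃ (I : Type) (b : Module.Basis I R (ExteriorAlgebra R M)),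
    ∀ (f : R) (x : ExteriorAlgebra R M), (∃ y, x = f • y) ↔ ∀ i, f ∣ b.repr x i := by
  have ⟨I, b⟩ := Module.Free.exists_basis R M
  let : LinearOrder I := linearOrderOfSTO WellOrderingRel
  refine ⟨_, b.ExteriorAlgebra, fun f x => ⟨?_, fun h => ?_⟩⟩
  · rintro ⟨y, rfl⟩ i
    simp
  · choose g hg using h
    refine ⟨∑ i ∈ (b.ExteriorAlgebra.repr x).support, g i • b.ExteriorAlgebra i, ?_⟩
    conv_lhs => rw [← b.ExteriorAlgebra.linearCombination_repr x, Finsupp.linearCombination_apply,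
      Finsupp.sum]
    rw [Finset.smul_sum]
    exact Finset.sum_congr rfl fun i _ => by rw [smul_smul, ← hg]

/-- Divisibility of forms by pairwise coprime elements. -/
lemma exists_prod_smul [Module.Free R M] [DecompositionMonoid R] {ι : Type} (s : Finset ι) (f : ι → R)
    (hf : ∀ i ∈ s, ∀ j ∈ s, i ≠ j → IsRelPrime (f i) (f j)) {x : ExteriorAlgebra R M}
    (hx : ∀ i ∈ s, ∃ y, x = f i • y) : ∃ y, x = (∏ i ∈ s, f i) • y := by
  obtain ⟨I, b, hb⟩ := exists_smul_iff_dvd (R := R) (M := M)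
  rw [hb]
  intro k
  refine Finset.prod_dvd_of_isRelPrime (fun i hi j hj hij => hf i hi j hj hij) ?_
  exact fun i hi => (hb _ _).mp (hx i hi) k

/-- Cancelling a coprime factor from a divisibility of forms. -/
lemma exists_smul_of_isRelPrime [Module.Free R M] [DecompositionMonoid R] {f g : R}
    (h : IsRelPrime f g) {x : ExteriorAlgebra R M} (hx : ∃ y, g • x = f • y) :
    ∃ y, x = f • y := by
  obtain ⟨I, b, hb⟩ := exists_smul_iff_dvd (R := R) (M := M)
  rw [hb] at hx ⊢
  intro k
  have := hx k
  rw [map_smul, Finsupp.smul_apply, smul_eq_mul] at this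
  exact h.dvd_of_dvd_mul_left this

end FreeExterior

section Pullback
variable {K : Type} [Field K] {k n ℓ : ℕ}

/-- The coefficient vector of the composition of a linear form with a linear map. -/
def rowF (L : (Fin n → K) →ₗ[K] (Fin ℓ → K)) (c : Fin ℓ → K) : Fin n → K :=
  fun i => ∑ j, c j * L (Pi.single i 1) j

lemma linearMap_apply_eq_sum (L : (Fin n → K) →ₗ[K] (Fin ℓ → K)) (y : Fin n → K) (j : Fin ℓ) :
    L y j = ∑ i, y i * L (Pi.single i 1) j := by
  conv_lhs => rw [pi_eq_sum_univ' y, map_sum, Finset.sum_apply]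
  exact Finset.sum_congr rfl fun i _ => by rw [map_smul, Pi.smul_apply, smul_eq_mul]

lemma rowF_dot (L : (Fin n → K) →ₗ[K] (Fin ℓ → K)) (c : Fin ℓ → K) (y : Fin n → K) :
    ∑ i, rowF L c i * y i = ∑ j, c j * L y j := by
  simp only [rowF, linearMap_apply_eq_sum L y, Finset.mul_sum, Finset.sum_mul]
  rw [Finset.sum_comm]
  exact Finset.sum_congr rfl fun j _ => Finset.sum_congr rfl fun i _ => by ring

lemma rowF_comp (L : (Fin n → K) →ₗ[K] (Fin ℓ → K)) (L' : (Fin k → K) →ₗ[K] (Fin n → K))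
    (c : Fin ℓ → K) : rowF L' (rowF L c) = rowF (L ∘ₗ L') c := by
  ext i
  exact rowF_dot L c _

lemma rowF_id (c : Fin ℓ → K) : rowF LinearMap.id c = c := by
  ext i
  simp [rowF, Pi.single_apply]

lemma rowF_smul (L : (Fin n → K) →ₗ[K] (Fin ℓ → K)) (t : K) (c : Fin ℓ → K) :
    rowF L (t • c) = t • rowF L c := by
  ext i
  simp [rowF, Finset.mul_sum, mul_assoc]

/-- The constant vector of polynomials. -/
def cst (c : Fin ℓ → K) : Fin ℓ → PS K ℓ := fun i => C (c i)

lemma dP_eq (c : Fin ℓ → K) : dP c = ExteriorAlgebra.ι (PS K ℓ) (cst c) := rfl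

lemma cst_add (c c' : Fin ℓ → K) : cst (c + c') = cst c + cst c' := by
  ext1 i
  simp [cst]

lemma cst_smul (t : K) (c : Fin ℓ → K) : cst (t • c) = (C t : PS K ℓ) • cst c := by
  ext1 i
  simp [cst]

lemma linP_add (c c' : Fin ℓ → K) : linP (c + c') = linP c + linP c' := by
  simp [linP, add_mul, Finset.sum_add_distrib]

lemma linP_smul (t : K) (c : Fin ℓ → K) : linP (t • c) = C t * linP c := by
  simp [linP, Finset.mul_sum, mul_assoc]

lemma dP_add (c c' : Fin ℓ → K) : dP (c + c') = dP c + dP c' := by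
  rw [dP_eq, cst_add, map_add]
  rfl

lemma dP_smul (t : K) (c : Fin ℓ → K) : dP (t • c) = (C t : PS K ℓ) • dP c := by
  rw [dP_eq, cst_smul, map_smul]
  rfl

lemma linP_single (j : Fin ℓ) : linP (Pi.single j (1 : K)) = X j := by
  simp [linP, Pi.single_apply]

/-- Pullback of polynomial functions along a linear map. -/
def pullP (L : (Fin n → K) →ₗ[K] (Fin ℓ → K)) : PS K ℓ →ₐ[K] PS K n :=
  aeval fun j => linP (rowF L (Pi.single j 1))

lemma pullP_X (L : (Fin n → K) →ₗ[K] (Fin ℓ → K)) (j : Fin ℓ) :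
    pullP L (X j) = ∑ i, C (L (Pi.single i 1) j) * X i := by
  simp [pullP, linP, rowF, Pi.single_apply]

@[simp] lemma pullP_C (L : (Fin n → K) →ₗ[K] (Fin ℓ → K)) (t : K) :
    pullP L (C t) = C t := by
  simp [pullP]

lemma pullP_linP (L : (Fin n → K) →ₗ[K] (Fin ℓ → K)) (c : Fin ℓ → K) :
    pullP L (linP c) = linP (rowF L c) := by
  simp only [linP, map_sum, map_mul, pullP_C, pullP_X, rowF, Finset.mul_sum, Finset.sum_mul]
  rw [Finset.sum_comm]
  exact Finset.sum_congr rfl fun j _ => Finset.sum_congr rfl fun i _ => by ring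

lemma pullP_comp (L : (Fin n → K) →ₗ[K] (Fin ℓ → K)) (L' : (Fin k → K) →ₗ[K] (Fin n → K))
    (f : PS K ℓ) : pullP L' (pullP L f) = pullP (L ∘ₗ L') f := by
  have : (pullP L').comp (pullP L) = pullP (L ∘ₗ L') := by
    ext1 j
    rw [AlgHom.comp_apply, ← linP_single, pullP_linP, pullP_linP, pullP_linP, rowF_comp]
  exact DFunLike.congr_fun this f

lemma pullP_id (f : PS K ℓ) : pullP LinearMap.id f = f := by
  have : pullP (LinearMap.id : (Fin ℓ → K) →ₗ[K] _) = AlgHom.id K (PS K ℓ) := by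
    ext1 j
    rw [← linP_single, pullP_linP, rowF_id, AlgHom.id_apply]
  rw [this, AlgHom.id_apply]

/-- Pullback of polynomial one-forms, in coordinates, along a linear map. -/
def pullV (L : (Fin n → K) →ₗ[K] (Fin ℓ → K)) :
    (Fin ℓ → PS K ℓ) →ₛₗ[(pullP L : PS K ℓ →+* PS K n)] (Fin n → PS K n) where
  toFun g := fun i => ∑ j, pullP L (g j) * C (L (Pi.single i 1) j)
  map_add' g g' := by
    ext1 i
    simp [add_mul, Finset.sum_add_distrib]
  map_smul' r g := by
    ext1 i
    simp [Finset.mul_sum, mul_assoc]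

lemma pullV_apply (L : (Fin n → K) →ₗ[K] (Fin ℓ → K)) (g : Fin ℓ → PS K ℓ) (i : Fin n) :
    pullV L g i = ∑ j, pullP L (g j) * C (L (Pi.single i 1) j) := rfl

lemma pullV_cst (L : (Fin n → K) →ₗ[K] (Fin ℓ → K)) (c : Fin ℓ → K) :
    pullV L (cst c) = cst (rowF L c) := by
  ext1 i
  simp [pullV_apply, cst, rowF]

lemma pullV_comp (L : (Fin n → K) →ₗ[K] (Fin ℓ → K)) (L' : (Fin k → K) →ₗ[K] (Fin n → K))
    (g : Fin ℓ → PS K ℓ) : pullV L' (pullV L g) = pullV (L ∘ₗ L') g := by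
  ext1 i
  simp only [pullV_apply, map_sum, map_mul, pullP_comp, pullP_C, LinearMap.comp_apply,
    linearMap_apply_eq_sum L (L' _), Finset.mul_sum, Finset.sum_mul]
  rw [Finset.sum_comm]
  exact Finset.sum_congr rfl fun j _ => Finset.sum_congr rfl fun i _ => by ring

lemma pullV_id (g : Fin ℓ → PS K ℓ) : pullV LinearMap.id g = g := by
  ext1 i
  simp [pullV_apply, pullP_id, Pi.single_apply]

/-- Pullback of polynomial differential forms along a linear map. -/
def pullF (L : (Fin n → K) →ₗ[K] (Fin ℓ → K)) : ExtF K ℓ →+* ExtF K n :=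
  extMap (pullP L : PS K ℓ →+* PS K n) (pullV L)

@[simp] lemma pullF_smul (L : (Fin n → K) →ₗ[K] (Fin ℓ → K)) (r : PS K ℓ) (x : ExtF K ℓ) :
    pullF L (r • x) = pullP L r • pullF L x :=
  extMap_smul _ _ r x

lemma pullF_algebraMap (L : (Fin n → K) →ₗ[K] (Fin ℓ → K)) (r : PS K ℓ) :
    pullF L (algebraMap _ _ r) = algebraMap _ _ (pullP L r) :=
  extMap_algebraMap _ _ r

lemma pullF_ι (L : (Fin n → K) →ₗ[K] (Fin ℓ → K)) (g : Fin ℓ → PS K ℓ) :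
    pullF L (ExteriorAlgebra.ι _ g) = ExteriorAlgebra.ι _ (pullV L g) :=
  extMap_ι _ _ g

lemma pullF_dP (L : (Fin n → K) →ₗ[K] (Fin ℓ → K)) (c : Fin ℓ → K) :
    pullF L (dP c) = dP (rowF L c) := by
  rw [dP_eq, pullF_ι, pullV_cst, dP_eq]

lemma pullF_mem (L : (Fin n → K) →ₗ[K] (Fin ℓ → K)) {p : ℕ} {x : ExtF K ℓ}
    (hx : x ∈ formsP K ℓ p) : pullF L x ∈ formsP K n p :=
  extMap_mem_extP _ _ hx

/-- The functional on one-forms given by a polynomial vector field. -/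
def vf (θ : Fin ℓ → PS K ℓ) : Module.Dual (PS K ℓ) (Fin ℓ → PS K ℓ) :=
  ∑ i, θ i • LinearMap.proj i

lemma vf_apply (θ g : Fin ℓ → PS K ℓ) : vf θ g = ∑ i, θ i * g i := by
  simp [vf]

lemma vf_cst_cst (v c : Fin ℓ → K) : vf (cst v) (cst c) = C (∑ i, c i * v i) := by
  simp [vf_apply, cst, mul_comm]

lemma vf_X_cst (c : Fin ℓ → K) : vf X (cst c) = linP c := by
  simp [vf_apply, cst, linP, mul_comm]

lemma pullP_vf_X (L : (Fin n → K) →ₗ[K] (Fin ℓ → K)) (g : Fin ℓ → PS K ℓ) :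
    pullP L (vf X g) = vf X (pullV L g) := by
  simp only [vf_apply, map_sum, map_mul, pullP_X, pullV_apply, Finset.mul_sum, Finset.sum_mul]
  rw [Finset.sum_comm]
  exact Finset.sum_congr rfl fun j _ => Finset.sum_congr rfl fun i _ => by ring

lemma pullF_ctr_X (L : (Fin n → K) →ₗ[K] (Fin ℓ → K)) (x : ExtF K ℓ) :
    pullF L (ctr (vf X) x) = ctr (vf X) (pullF L x) :=
  extMap_ctr _ _ _ _ (pullP_vf_X L) x

/-- A hyperplane `ker c0` of `K^ℓ`, parametrized by `e`, together with a splitting. -/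
structure HypData (K : Type) [Field K] (n ℓ : ℕ) where
  c0 : Fin ℓ → K
  e : (Fin n → K) →ₗ[K] (Fin ℓ → K)
  pr : (Fin ℓ → K) →ₗ[K] (Fin n → K)
  v : Fin ℓ → K
  dot_e : ∀ y, ∑ i, c0 i * e y i = 0
  pr_e : pr ∘ₗ e = LinearMap.id
  dot_v : ∑ i, c0 i * v i = 1
  decomp : ∀ x, x = e (pr x) + (∑ i, c0 i * x i) • v

namespace HypData
variable (D : HypData K n ℓ)

/-- Contraction with the constant vector field transversal to the hyperplane. -/
abbrev cv : ExtF K ℓ →ₗ[PS K ℓ] ExtF K ℓ := ctr (vf (cst D.v))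

lemma rowF_c0 : rowF D.e D.c0 = 0 := by
  ext i
  exact D.dot_e _

lemma pullP_α : pullP D.e (linP D.c0) = 0 := by
  rw [pullP_linP, D.rowF_c0]
  simp [linP]

lemma pullF_dα : pullF D.e (dP D.c0) = 0 := by
  rw [pullF_dP, D.rowF_c0]
  simp [dP_eq, show cst (0 : Fin n → K) = 0 from funext fun i => C_0]

lemma pullP_pullP_pr (x : PS K n) : pullP D.e (pullP D.pr x) = x := by
  rw [pullP_comp, D.pr_e, pullP_id]

lemma pullP_surjective : Function.Surjective (pullP D.e) :=
  fun f => ⟨_, D.pullP_pullP_pr f⟩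

lemma cv_smul (r : PS K ℓ) (x : ExtF K ℓ) : D.cv (r • x) = r • D.cv x :=
  map_smul _ _ _

lemma cv_dα_mul (x : ExtF K ℓ) : D.cv (dP D.c0 * x) = x - dP D.c0 * D.cv x := by
  rw [dP_eq, ctr_ι_mul, vf_cst_cst, D.dot_v, C_1, one_smul]

lemma exists_sub_eq_α_mul (f : PS K ℓ) : ∃ g, f = pullP D.pr (pullP D.e f) + linP D.c0 * g := by
  rw [pullP_comp]
  induction f using MvPolynomial.induction_on with
  | C t => exact ⟨0, by simp⟩
  | add f g hf hg =>
    obtain ⟨f', hf'⟩ := hf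
    obtain ⟨g', hg'⟩ := hg
    refine ⟨f' + g', ?_⟩
    conv_lhs => rw [hf', hg']
    rw [map_add]
    ring
  | mul_X f j hf =>
    obtain ⟨f', hf'⟩ := hf
    have hX : (X j : PS K ℓ) = pullP (D.e ∘ₗ D.pr) (X j) + linP D.c0 * C (D.v j) := by
      rw [← linP_single, pullP_linP]
      have : (Pi.single j 1 : Fin ℓ → K) =
          rowF (D.e ∘ₗ D.pr) (Pi.single j 1) + D.v j • D.c0 := by
        ext i
        have h := congrFun (D.decomp (Pi.single i 1)) j
        simp only [Pi.add_apply, Pi.smul_apply, smul_eq_mul, Pi.single_apply, mul_ite, mul_one,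
          mul_zero, Finset.sum_ite_eq', Finset.mem_univ, if_true, ite_mul, one_mul, zero_mul,
          rowF, LinearMap.comp_apply] at h ⊢
        rw [show (if i = j then (1 : K) else 0) = if j = i then 1 else 0 by simp only [eq_comm],
          h, mul_comm]
      conv_lhs => rw [this, linP_add, linP_smul]
      rw [mul_comm]
    refine ⟨pullP (D.e ∘ₗ D.pr) f * C (D.v j) + f' * X j, ?_⟩
    rw [map_mul]
    linear_combination X j * hf' + pullP (D.e ∘ₗ D.pr) f * hX

lemma pullP_eq_zero_iff (f : PS K ℓ) : pullP D.e f = 0 ↔ ∃ g, f = linP D.c0 * g := by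
  constructor
  · intro h
    obtain ⟨g, hg⟩ := D.exists_sub_eq_α_mul f
    exact ⟨g, by rw [hg, h, map_zero, zero_add]⟩
  · rintro ⟨g, rfl⟩
    rw [map_mul, D.pullP_α, zero_mul]

lemma exists_vec_decomp (m : Fin ℓ → PS K ℓ) : ∃ (m' : Fin ℓ → PS K ℓ) (t : PS K ℓ),
    m = pullV D.pr (pullV D.e m) + linP D.c0 • m' + t • cst D.c0 := by
  choose m' hm' using fun i => D.exists_sub_eq_α_mul (m i)
  simp only [pullP_comp] at hm'
  refine ⟨m', ∑ j, pullP (D.e ∘ₗ D.pr) (m j) * C (D.v j), ?_⟩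
  rw [pullV_comp]
  ext1 i
  have h : ∀ j, D.e (D.pr (Pi.single i 1)) j = (if i = j then 1 else 0) - D.c0 i * D.v j := by
    intro j
    have h := congrFun (D.decomp (Pi.single i 1)) j
    simp only [Pi.add_apply, Pi.smul_apply, smul_eq_mul, Pi.single_apply, mul_ite, mul_one,
      mul_zero, Finset.sum_ite_eq', Finset.mem_univ, if_true] at h
    rw [show (if i = j then (1 : K) else 0) = if j = i then 1 else 0 by simp only [eq_comm], h]
    ring
  simp only [Pi.add_apply, Pi.smul_apply, smul_eq_mul, pullV_apply, LinearMap.comp_apply, h, cst,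
    C_sub, C_mul, mul_sub, Finset.sum_sub_distrib, Finset.sum_mul]
  conv_lhs => rw [hm' i]
  have h1 : ∑ x, pullP (D.e ∘ₗ D.pr) (m x) * C (if i = x then (1 : K) else 0) =
      pullP (D.e ∘ₗ D.pr) (m i) := by simp [apply_ite]
  have h2 : ∑ x, pullP (D.e ∘ₗ D.pr) (m x) * (C (D.c0 i) * C (D.v x)) =
      ∑ x, pullP (D.e ∘ₗ D.pr) (m x) * C (D.v x) * (C (D.c0 i) : PS K ℓ) :=
    Finset.sum_congr rfl fun x _ => by ring
  rw [h1, h2]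
  ring

lemma exists_form_decomp (x : ExtF K ℓ) : ∃ a b,
    x = pullF D.pr (pullF D.e x) + linP D.c0 • a + dP D.c0 * b := by
  induction x using ext_induction with
  | algebraMap r =>
    obtain ⟨g, hg⟩ := D.exists_sub_eq_α_mul r
    refine ⟨algebraMap _ _ g, 0, ?_⟩
    rw [pullF_algebraMap, pullF_algebraMap, Algebra.smul_def, ← map_mul, ← map_add, ← hg, mul_zero,
      add_zero]
  | add x y hx hy =>
    obtain ⟨a, b, h⟩ := hx
    obtain ⟨a', b', h'⟩ := hy
    refine ⟨a + a', b + b', ?_⟩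
    conv_lhs => rw [h, h']
    rw [map_add, map_add, smul_add, mul_add]
    abel
  | ι_mul m x hx =>
    obtain ⟨a, b, h⟩ := hx
    obtain ⟨m', t, hm⟩ := D.exists_vec_decomp m
    set y := pullF D.pr (pullF D.e x) with hy
    set w := pullV D.pr (pullV D.e m) with hw
    have hmx : pullF D.pr (pullF D.e (ExteriorAlgebra.ι _ m * x)) = ExteriorAlgebra.ι _ w * y := by
      rw [map_mul, map_mul, pullF_ι, pullF_ι]
    refine ⟨ExteriorAlgebra.ι _ m' * y + ExteriorAlgebra.ι _ m * a,
      t • y - ExteriorAlgebra.ι _ m * b, ?_⟩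
    have h3 : ExteriorAlgebra.ι (PS K ℓ) m * (dP D.c0 * b) =
        - (dP D.c0 * (ExteriorAlgebra.ι (PS K ℓ) m * b)) := ι_mul_swap _ _ _
    have h4 : ExteriorAlgebra.ι (PS K ℓ) m * y = ExteriorAlgebra.ι _ w * y +
        linP D.c0 • (ExteriorAlgebra.ι _ m' * y) + dP D.c0 * (t • y) := by
      conv_lhs => rw [hm]
      rw [map_add, map_add, map_smul, map_smul, add_mul, add_mul, smul_mul_assoc, smul_mul_assoc,
        mul_smul_comm, dP_eq]
    rw [hmx]
    conv_lhs => rw [h]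
    rw [mul_add, mul_add, h3, h4, mul_smul_comm (linP D.c0), smul_add, mul_sub]
    abel

/-- A form pulls back to zero on the hyperplane iff `dα ∧ x` is divisible by `α`. -/
lemma pullF_eq_zero_iff (x : ExtF K ℓ) : pullF D.e x = 0 ↔ ∃ y, dP D.c0 * x = linP D.c0 • y := by
  constructor
  · intro h
    obtain ⟨a, b, hx⟩ := D.exists_form_decomp x
    refine ⟨dP D.c0 * a, ?_⟩
    rw [hx, h, map_zero, zero_add, mul_add, mul_smul_comm]
    conv_lhs => rw [show dP D.c0 * (dP D.c0 * b) = 0 from ι_mul_self_mul _ _]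
    rw [add_zero]
  · rintro ⟨y, hy⟩
    have h := congrArg (fun z => pullF D.e (D.cv z)) hy
    simpa only [cv_dα_mul, cv_smul, map_sub, map_add, map_mul, pullF_smul, D.pullP_α, D.pullF_dα,
      zero_smul, zero_mul, sub_zero, zero_add] using h

lemma exists_eq_α_smul_iff (x : ExtF K ℓ) :
    (∃ y, x = linP D.c0 • y) ↔ pullF D.e x = 0 ∧ pullF D.e (D.cv x) = 0 := by
  constructor
  · rintro ⟨y, rfl⟩
    simp only [cv_smul, pullF_smul, D.pullP_α, zero_smul, and_self]
  · rintro ⟨h1, h2⟩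
    obtain ⟨a, b, hx⟩ := D.exists_form_decomp x
    rw [h1, map_zero, zero_add] at hx
    rw [hx] at h2
    have h3 : pullF D.e b = 0 := by
      simpa only [cv_dα_mul, cv_smul, map_sub, map_add, map_mul, pullF_smul, D.pullP_α, D.pullF_dα,
      zero_smul, zero_mul, sub_zero, zero_add] using h2
    obtain ⟨y, hy⟩ := (D.pullF_eq_zero_iff b).mp h3
    exact ⟨a + y, by rw [hx, hy, smul_add]⟩

end HypData

end Pullback

section LinearForms
variable {K : Type} [Field K] {n ℓ : ℕ}

lemma eval_linP (c x : Fin ℓ → K) : eval x (linP c) = ∑ i, c i * x i := by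
  simp [linP]

lemma eq_zero_of_dot {c : Fin ℓ → K} (h : ∀ x : Fin ℓ → K, ∑ i, c i * x i = 0) : c = 0 := by
  ext i
  simpa [Pi.single_apply] using h (Pi.single i 1)

lemma linP_eq_zero {c : Fin ℓ → K} (h : linP c = 0) : c = 0 :=
  eq_zero_of_dot fun x => by rw [← eval_linP, h, map_zero]

lemma linP_ne_zero {c : Fin ℓ → K} (h : c ≠ 0) : linP c ≠ 0 := fun h' => h (linP_eq_zero h')

lemma dotLin_apply (c x : Fin ℓ → K) : dotLin c x = ∑ i, c i * x i := by
  simp [dotLin]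

lemma exists_hypData {c : Fin ℓ → K} (hc : c ≠ 0) (e : (Fin n → K) →ₗ[K] (Fin ℓ → K))
    (he : Function.Injective e) (hr : LinearMap.range e = LinearMap.ker (dotLin c)) :
    ∃ D : HypData K n ℓ, D.c0 = c ∧ D.e = e := by
  obtain ⟨w, hw⟩ : ∃ w : Fin ℓ → K, ∑ i, c i * w i ≠ 0 := by
    by_contra! h
    exact hc (eq_zero_of_dot h)
  set v : Fin ℓ → K := (∑ i, c i * w i)⁻¹ • w with hv
  have hcv : dotLin c v = 1 := by
    rw [hv, map_smul, dotLin_apply, smul_eq_mul, inv_mul_cancel₀ hw]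
  obtain ⟨g, hg⟩ := LinearMap.exists_leftInverse_of_injective e (LinearMap.ker_eq_bot.mpr he)
  have hker : ∀ y, dotLin c (e y) = 0 := fun y => by
    rw [← LinearMap.mem_ker, ← hr]
    exact ⟨y, rfl⟩
  have hproj : ∀ x, e ((g ∘ₗ (LinearMap.id - (dotLin c).smulRight v)) x) =
      x - dotLin c x • v := by
    intro x
    have hx : x - dotLin c x • v ∈ LinearMap.range e := by
      rw [hr, LinearMap.mem_ker, map_sub, map_smul, hcv, smul_eq_mul, mul_one, sub_self]
    obtain ⟨y, hy⟩ := hx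
    have hgy : g (e y) = y := LinearMap.congr_fun hg y
    simp only [LinearMap.comp_apply, LinearMap.sub_apply, LinearMap.id_apply,
      LinearMap.smulRight_apply, ← hy, hgy]
  refine ⟨⟨c, e, g ∘ₗ (LinearMap.id - (dotLin c).smulRight v), v, ?_, ?_, ?_, ?_⟩, rfl, rfl⟩
  · exact fun y => by rw [← dotLin_apply, hker]
  · refine LinearMap.ext fun y => he ?_
    rw [LinearMap.comp_apply, hproj, hker, zero_smul, sub_zero, LinearMap.id_apply]
  · rw [← dotLin_apply, hcv]
  · exact fun x => by rw [hproj, dotLin_apply, sub_add_cancel]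

lemma exists_embedding {c : Fin ℓ → K} (hc : c ≠ 0) :
    ∃ e : (Fin (ℓ - 1) → K) →ₗ[K] (Fin ℓ → K),
      Function.Injective e ∧ LinearMap.range e = LinearMap.ker (dotLin c) := by
  have hs : LinearMap.range (dotLin c) = ⊤ := by
    refine LinearMap.range_eq_top.mpr (LinearMap.surjective ?_)
    intro h
    exact hc (eq_zero_of_dot fun x => by rw [← dotLin_apply, h, LinearMap.zero_apply])
  have hd : Module.finrank K (LinearMap.ker (dotLin c)) = ℓ - 1 := by
    have := LinearMap.finrank_range_add_finrank_ker (dotLin c)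
    rw [hs, finrank_top, Module.finrank_self, Module.finrank_fin_fun] at this
    omega
  have b := (Module.finBasisOfFinrankEq K _ hd).equivFun.symm
  refine ⟨(LinearMap.ker (dotLin c)).subtype ∘ₗ b.toLinearMap,
    Subtype.val_injective.comp b.injective, ?_⟩
  rw [LinearMap.range_comp, LinearEquiv.range, Submodule.map_top, Submodule.range_subtype]

namespace HypData
variable (D : HypData K n ℓ)

lemma prime_linP : Prime (linP D.c0) := by
  have hdvd : ∀ f, linP D.c0 ∣ f ↔ pullP D.e f = 0 := fun f => (D.pullP_eq_zero_iff f).symm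
  refine ⟨fun h => ?_, fun h => ?_, fun f g hfg => ?_⟩
  · have := D.dot_v
    rw [linP_eq_zero h] at this
    simp at this
  · have := h.map (pullP D.e)
    rw [D.pullP_α] at this
    exact not_isUnit_zero this
  · rw [hdvd, map_mul, mul_eq_zero] at hfg
    rwa [hdvd, hdvd]

lemma eq_add_smul_of_rowF_eq {c d : Fin ℓ → K} (h : rowF D.e c = rowF D.e d) :
    ∃ u : K, c = d + u • D.c0 := by
  refine ⟨∑ i, c i * D.v i - ∑ i, d i * D.v i, ?_⟩
  rw [← sub_eq_zero]
  refine eq_zero_of_dot fun x => ?_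
  have h1 := rowF_dot D.e c (D.pr x)
  have h2 := rowF_dot D.e d (D.pr x)
  rw [h] at h1
  have h3 : ∀ a : Fin ℓ → K, ∑ i, a i * x i = ∑ i, a i * D.e (D.pr x) i +
      (∑ i, D.c0 i * x i) * ∑ i, a i * D.v i := by
    intro a
    conv_lhs => rw [D.decomp x]
    simp only [Pi.add_apply, Pi.smul_apply, smul_eq_mul, mul_add, Finset.sum_add_distrib,
      Finset.mul_sum]
    congr 1
    exact Finset.sum_congr rfl fun i _ => by ring
  have h4 := h3 c
  have h5 := h3 d
  simp only [Pi.sub_apply, Pi.add_apply, Pi.smul_apply, smul_eq_mul, sub_mul, add_mul,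
    Finset.sum_sub_distrib, Finset.sum_add_distrib, mul_assoc, ← Finset.mul_sum] at h4 h5 ⊢
  linear_combination h4 - h5 + h2 - h1

end HypData

lemma prime_linP {c : Fin ℓ → K} (hc : c ≠ 0) : Prime (linP c) := by
  obtain ⟨e, he, hr⟩ := exists_embedding hc
  obtain ⟨D, rfl, -⟩ := exists_hypData hc e he hr
  exact D.prime_linP

lemma isRelPrime_linP {c d : Fin ℓ → K} (hc : c ≠ 0) (hd : ∀ t : K, d ≠ t • c) :
    IsRelPrime (linP c) (linP d) := by
  rw [(prime_linP hc).irreducible.isRelPrime_iff_not_dvd]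
  rintro ⟨g, hg⟩
  obtain ⟨e, he, hr⟩ := exists_embedding hc
  obtain ⟨D, rfl, -⟩ := exists_hypData hc e he hr
  have h := congrArg (pullP D.e) hg
  rw [map_mul, D.pullP_α, zero_mul, pullP_linP] at h
  have h0 : rowF D.e d = rowF D.e (0 : Fin ℓ → K) := by
    rw [linP_eq_zero h]
    ext i
    simp [rowF]
  obtain ⟨u, hu⟩ := D.eq_add_smul_of_rowF_eq h0
  exact hd u (by rw [hu, zero_add])

end LinearForms

section LogForms
variable {K : Type} [Field K] {n ℓ : ℕ}

/-- The polynomial model of the logarithmic `p`-forms of a simple arrangement. -/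
abbrev Om (A : Arrangement K ℓ) (p : ℕ) : Submodule (PS K ℓ) (ExtF K ℓ) :=
  Omega A (fun _ => 1) p

/-- The defining polynomial of a simple arrangement. -/
def Qa (A : Arrangement K ℓ) : PS K ℓ := ∏ c ∈ A.hyps, linP c

lemma Qa_ne_zero (A : Arrangement K ℓ) : Qa A ≠ 0 :=
  Finset.prod_ne_zero_iff.mpr fun c hc => linP_ne_zero (A.ne_zero c hc)

lemma Arrangement.isRelPrime (A : Arrangement K ℓ) : ∀ c ∈ A.hyps, ∀ d ∈ A.hyps, c ≠ d →
    IsRelPrime (linP c) (linP d) :=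
  fun c hc d hd h => isRelPrime_linP (A.ne_zero c hc) (A.nonprop d hd c hc h.symm)

/-- The logarithmic condition on a differential form. -/
def IsLog (A : Arrangement K ℓ) (η : ExtF K ℓ) : Prop :=
  ∀ c ∈ A.hyps, ∃ ζ, dP c * η = linP c • ζ

lemma mem_Om {A : Arrangement K ℓ} {p : ℕ} {η : ExtF K ℓ} :
    η ∈ Om A p ↔ η ∈ formsP K ℓ p ∧ IsLog A η := by
  simp only [Om, Omega, Submodule.mem_inf, Submodule.mem_iInf, Submodule.mem_comap,
    Submodule.mem_map, IsLog, pow_one, LinearMap.mulLeft_apply, LinearMap.lsmul_apply]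
  refine and_congr_right fun hη => forall₂_congr fun c hc => ⟨?_, ?_⟩
  · rintro ⟨ζ, -, h⟩
    exact ⟨ζ, h.symm⟩
  · rintro ⟨ζ, h⟩
    refine ⟨ζ, mem_extP_of_smul_mem (linP_ne_zero (A.ne_zero c hc)) ?_, h.symm⟩
    rw [← h]
    exact ι_mul_mem_extP _ hη

lemma smul_right_inj_ext {f : PS K ℓ} (hf : f ≠ 0) {x y : ExtF K ℓ} (h : f • x = f • y) :
    x = y := by
  have := isTorsionFree_exteriorAlgebra (R := PS K ℓ) (M := Fin ℓ → PS K ℓ)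
  exact smul_right_injective _ hf h

lemma dP_mul_smul (c : Fin ℓ → K) (f : PS K ℓ) (x : ExtF K ℓ) : dP c * f • x = f • (dP c * x) :=
  mul_smul_comm _ _ _

lemma IsLog.of_smul {A : Arrangement K ℓ} {f : PS K ℓ} {η : ExtF K ℓ}
    (hf : ∀ c ∈ A.hyps, IsRelPrime (linP c) f) (h : IsLog A (f • η)) : IsLog A η := by
  intro c hc
  refine exists_smul_of_isRelPrime (hf c hc) ?_
  rw [← dP_mul_smul]
  exact h c hc

lemma IsLog.smul {A : Arrangement K ℓ} (f : PS K ℓ) {η : ExtF K ℓ} (h : IsLog A η) :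
    IsLog A (f • η) := by
  intro c hc
  obtain ⟨ζ, hζ⟩ := h c hc
  exact ⟨f • ζ, by rw [dP_mul_smul, hζ, smul_comm]⟩

lemma ctr_dP_mul (θ : Fin ℓ → PS K ℓ) (c : Fin ℓ → K) (x : ExtF K ℓ) :
    ctr (vf θ) (dP c * x) = vf θ (cst c) • x - dP c * ctr (vf θ) x :=
  ctr_ι_mul _ _ _

lemma IsLog.contract {A : Arrangement K ℓ} {θ : Fin ℓ → PS K ℓ}
    (hθ : ∀ c ∈ A.hyps, linP c ∣ vf θ (cst c)) {η : ExtF K ℓ} (h : IsLog A η) :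
    IsLog A (ctr (vf θ) η) := by
  intro c hc
  obtain ⟨ζ, hζ⟩ := h c hc
  obtain ⟨g, hg⟩ := hθ c hc
  have h1 := congrArg (ctr (vf θ)) hζ
  rw [ctr_dP_mul, map_smul, hg] at h1
  exact ⟨g • η - ctr (vf θ) ζ, by rw [smul_sub, ← h1, smul_smul]; abel⟩

lemma IsLog.contract_X {A : Arrangement K ℓ} {η : ExtF K ℓ} (h : IsLog A η) :
    IsLog A (ctr (vf X) η) :=
  h.contract fun c _ => by rw [vf_X_cst]

/-- `A' = A ∖ {H}` and `B = A^H` for the hyperplane `H` given by `D`. -/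
structure Triple (D : HypData K n ℓ) (A A' : Arrangement K ℓ) (B : Arrangement K n) : Prop where
  mem_iff : ∀ c, c ∈ A.hyps ↔ c = D.c0 ∨ c ∈ A'.hyps
  notMem : D.c0 ∉ A'.hyps
  restr : ∀ c ∈ A'.hyps, ∃ c' ∈ B.hyps, ∃ t : K, t ≠ 0 ∧ rowF D.e c = t • c'
  lift : ∀ c' ∈ B.hyps, ∃ c ∈ A'.hyps, ∃ t : K, t ≠ 0 ∧ rowF D.e c = t • c'

namespace Triple
variable {D : HypData K n ℓ} {A A' : Arrangement K ℓ} {B : Arrangement K n}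

lemma isLog_iff (h : Triple D A A' B) {η : ExtF K ℓ} :
    IsLog A η ↔ pullF D.e η = 0 ∧ IsLog A' η := by
  simp only [IsLog, h.mem_iff, forall_eq_or_imp, D.pullF_eq_zero_iff]

lemma isRelPrime_α (h : Triple D A A' B) : ∀ c ∈ A'.hyps, IsRelPrime (linP c) (linP D.c0) :=
  fun c hc => A.isRelPrime c ((h.mem_iff c).mpr (Or.inr hc)) _ ((h.mem_iff _).mpr (Or.inl rfl))
    fun hcc => h.notMem (hcc ▸ hc)

lemma mem_Om_iff_of_mem (h : Triple D A A' B) {p : ℕ} {η : ExtF K ℓ} :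
    η ∈ Om A p ↔ η ∈ Om A' p ∧ pullF D.e η = 0 := by
  rw [mem_Om, mem_Om, h.isLog_iff]
  tauto

lemma α_smul_mem (h : Triple D A A' B) {p : ℕ} {η : ExtF K ℓ} (hη : η ∈ Om A' p) :
    linP D.c0 • η ∈ Om A p := by
  rw [h.mem_Om_iff_of_mem]
  exact ⟨Submodule.smul_mem _ _ hη, by rw [pullF_smul, D.pullP_α, zero_smul]⟩

lemma c0_ne_zero (h : Triple D A A' B) : D.c0 ≠ 0 := A.ne_zero _ ((h.mem_iff _).mpr (Or.inl rfl))

/-- The kernel of the residue map. -/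
lemma exists_α_smul (h : Triple D A A' B) {p : ℕ} {η : ExtF K ℓ} (hη : η ∈ Om A p)
    (hr : pullF D.e (D.cv η) = 0) : ∃ ζ ∈ Om A' p, η = linP D.c0 • ζ := by
  have hη' := h.mem_Om_iff_of_mem.mp hη
  obtain ⟨ζ, rfl⟩ := (D.exists_eq_α_smul_iff η).mpr ⟨hη'.2, hr⟩
  refine ⟨ζ, mem_Om.mpr ⟨?_, ?_⟩, rfl⟩
  · exact mem_extP_of_smul_mem (linP_ne_zero h.c0_ne_zero) (mem_Om.mp hη).1
  · exact IsLog.of_smul h.isRelPrime_α (mem_Om.mp hη'.1).2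

lemma res_mem (h : Triple D A A' B) {p : ℕ} {η : ExtF K ℓ} (hη : η ∈ Om A (p + 1)) :
    pullF D.e (D.cv η) ∈ Om B p := by
  have hη' := h.mem_Om_iff_of_mem.mp hη
  refine mem_Om.mpr ⟨pullF_mem _ (ctr_mem_extP _ (mem_Om.mp hη).1), fun c' hc' => ?_⟩
  obtain ⟨c, hc, t, ht, hct⟩ := h.lift c' hc'
  obtain ⟨ζ, hζ⟩ := (mem_Om.mp hη'.1).2 c hc
  have h1 := congrArg (fun z => pullF D.e (D.cv z)) hζ
  simp only [HypData.cv] at h1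
  rw [ctr_dP_mul, map_smul, map_sub, pullF_smul, hη'.2, smul_zero, zero_sub, map_mul, pullF_smul,
    pullF_dP, pullP_linP, hct, linP_smul, dP_smul, mul_smul, smul_mul_assoc, ← smul_neg] at h1
  have h2 := smul_right_inj_ext (C_ne_zero.mpr ht) h1
  refine ⟨-pullF D.e (ctr (vf (cst D.v)) ζ), ?_⟩
  rw [smul_neg, ← h2, neg_neg]

end Triple

end LogForms

section Multiplicity
variable {K : Type} [Field K] {n ℓ : ℕ}

/-- The hyperplanes of `A` restricting to the hyperplane `c'`. -/
def fib (D : HypData K n ℓ) (A : Arrangement K ℓ) (c' : Fin n → K) : Finset (Fin ℓ → K) :=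
  A.hyps.filter fun c => ∃ t : K, t ≠ 0 ∧ rowF D.e c = t • c'

lemma mem_fib {D : HypData K n ℓ} {A : Arrangement K ℓ} {c' : Fin n → K} {c : Fin ℓ → K} :
    c ∈ fib D A c' ↔ c ∈ A.hyps ∧ ∃ t : K, t ≠ 0 ∧ rowF D.e c = t • c' :=
  Finset.mem_filter

lemma pullP_prod_fib (D : HypData K n ℓ) (A : Arrangement K ℓ) (c' : Fin n → K)
    {s : Finset (Fin ℓ → K)} (hs : s ⊆ fib D A c') : ∃ T : K, T ≠ 0 ∧
      pullP D.e (∏ c ∈ s, linP c) = C T * linP c' ^ s.card := by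
  induction s using Finset.induction_on with
  | empty => exact ⟨1, one_ne_zero, by simp⟩
  | insert c s hc ih =>
    obtain ⟨T, hT, h⟩ := ih ((Finset.subset_insert c s).trans hs)
    obtain ⟨-, t, ht, hct⟩ := mem_fib.mp (hs (Finset.mem_insert_self c s))
    refine ⟨t * T, mul_ne_zero ht hT, ?_⟩
    rw [Finset.prod_insert hc, map_mul, h, pullP_linP, hct, linP_smul, Finset.card_insert_of_notMem hc,
      C_mul, pow_succ]
    ring

lemma exists_of_mem_fib {D : HypData K n ℓ} {A : Arrangement K ℓ} {c' : Fin n → K}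
    {c d : Fin ℓ → K} (hc : c ∈ fib D A c') (hd : d ∈ fib D A c') :
    ∃ s u : K, c = s • d + u • D.c0 := by
  obtain ⟨-, t, ht, hct⟩ := mem_fib.mp hc
  obtain ⟨-, r, hr, hdr⟩ := mem_fib.mp hd
  refine ⟨t * r⁻¹, D.eq_add_smul_of_rowF_eq ?_⟩
  rw [rowF_smul, hct, hdr, smul_smul, mul_assoc, inv_mul_cancel₀ hr, mul_one]

lemma ι_mul_dP_mul {c d a : Fin ℓ → K} {s u : K} (h : c = s • d + u • a) (x : ExtF K ℓ) :
    dP a * (dP c * x) = (C s : PS K ℓ) • (dP a * (dP d * x)) := by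
  rw [h, dP_add, add_mul, mul_add, dP_smul, dP_smul, smul_mul_assoc, smul_mul_assoc, dP_mul_smul,
    dP_mul_smul, show dP a * (dP a * x) = 0 from ι_mul_self_mul _ _, smul_zero, add_zero]

/-- The multiplicity polynomial of the restriction of `A'` to the hyperplane of `D`. -/
def IsMultPoly (D : HypData K n ℓ) (A' : Arrangement K ℓ) (B : Arrangement K n) (b : PS K n) :
    Prop :=
  ∃ T : K, T ≠ 0 ∧ b = C T * ∏ c' ∈ B.hyps, linP c' ^ ((fib D A' c').card - 1)

lemma IsMultPoly.ne_zero {D : HypData K n ℓ} {A' : Arrangement K ℓ} {B : Arrangement K n}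
    {b : PS K n} (hb : IsMultPoly D A' B b) : b ≠ 0 := by
  obtain ⟨T, hT, rfl⟩ := hb
  exact mul_ne_zero (C_ne_zero.mpr hT) (Finset.prod_ne_zero_iff.mpr fun c hc =>
    pow_ne_zero _ (linP_ne_zero (B.ne_zero c hc)))

lemma isUnit_C {T : K} (hT : T ≠ 0) : IsUnit (C T : PS K n) :=
  (isUnit_iff_ne_zero.mpr hT).map C

lemma IsMultPoly.dvd {D : HypData K n ℓ} {A' : Arrangement K ℓ} {B : Arrangement K n}
    {b : PS K n} (hb : IsMultPoly D A' B b) {f : PS K n}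
    (hf : ∀ c' ∈ B.hyps, linP c' ^ ((fib D A' c').card - 1) ∣ f) : b ∣ f := by
  obtain ⟨T, hT, rfl⟩ := hb
  rw [(isUnit_C hT).mul_left_dvd]
  exact Finset.prod_dvd_of_isRelPrime (fun c hc d hd hcd => (B.isRelPrime c hc d hd hcd).pow) hf

lemma IsMultPoly.exists_smul {D : HypData K n ℓ} {A' : Arrangement K ℓ} {B : Arrangement K n}
    {b : PS K n} (hb : IsMultPoly D A' B b) {x : ExtF K n}
    (hx : ∀ c' ∈ B.hyps, ∃ y, x = linP c' ^ ((fib D A' c').card - 1) • y) : ∃ y, x = b • y := by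
  obtain ⟨T, hT, rfl⟩ := hb
  obtain ⟨y, hy⟩ := exists_prod_smul B.hyps (fun c' => linP c' ^ ((fib D A' c').card - 1))
    (fun c hc d hd hcd => (B.isRelPrime c hc d hd hcd).pow) hx
  refine ⟨(C T⁻¹ : PS K n) • y, ?_⟩
  rw [smul_smul, mul_right_comm, ← C_mul, mul_inv_cancel₀ hT, C_1, one_mul, hy]

lemma IsMultPoly.factor {D : HypData K n ℓ} {A' : Arrangement K ℓ} {B : Arrangement K n}
    {b : PS K n} (hb : IsMultPoly D A' B b) {c' : Fin n → K} (hc' : c' ∈ B.hyps) :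
    ∃ b', b = linP c' ^ ((fib D A' c').card - 1) * b' ∧ IsRelPrime (linP c') b' := by
  obtain ⟨T, hT, rfl⟩ := hb
  refine ⟨C T * ∏ d ∈ B.hyps.erase c', linP d ^ ((fib D A' d).card - 1), ?_, ?_⟩
  · rw [← Finset.mul_prod_erase _ _ hc']
    ring
  · rw [IsRelPrime.mul_right_iff]
    refine ⟨(isUnit_C hT).isRelPrime_right, IsRelPrime.prod_right fun d hd => ?_⟩
    exact (B.isRelPrime c' hc' d (Finset.mem_of_mem_erase hd)
      (Finset.ne_of_mem_erase hd).symm).pow_right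

namespace Triple
variable {D : HypData K n ℓ} {A A' : Arrangement K ℓ} {B : Arrangement K n}

lemma card_fib_pos (h : Triple D A A' B) {c' : Fin n → K} (hc' : c' ∈ B.hyps) :
    0 < (fib D A' c').card := by
  obtain ⟨c, hc, t, ht, hct⟩ := h.lift c' hc'
  exact Finset.card_pos.mpr ⟨c, mem_fib.mpr ⟨hc, t, ht, hct⟩⟩

lemma exists_isMultPoly (h : Triple D A A' B) :
    ∃ b, IsMultPoly D A' B b ∧ b * Qa B = pullP D.e (Qa A') := by
  have hA : A'.hyps = B.hyps.biUnion (fib D A') := by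
    ext c
    rw [Finset.mem_biUnion]
    constructor
    · intro hc
      obtain ⟨c', hc', ht⟩ := h.restr c hc
      exact ⟨c', hc', mem_fib.mpr ⟨hc, ht⟩⟩
    · rintro ⟨c', -, hc⟩
      exact (mem_fib.mp hc).1
  have hdisj : Set.PairwiseDisjoint (B.hyps : Set (Fin n → K)) (fib D A') := by
    intro c' hc' d' hd' hne
    rw [Function.onFun, Finset.disjoint_left]
    intro c hc hd
    obtain ⟨-, t, ht, hct⟩ := mem_fib.mp hc
    obtain ⟨-, r, hr, hcr⟩ := mem_fib.mp hd
    refine B.nonprop c' hc' d' hd' hne (t⁻¹ * r) ?_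
    rw [mul_smul, ← hcr, hct, smul_smul, inv_mul_cancel₀ ht, one_smul]
  choose T hT hprod using fun c' => pullP_prod_fib D A' c' (Finset.Subset.refl _)
  refine ⟨_, ⟨∏ c' ∈ B.hyps, T c', Finset.prod_ne_zero_iff.mpr fun c _ => hT c, rfl⟩, ?_⟩
  rw [Qa, Qa, hA, Finset.prod_biUnion hdisj, map_prod, map_prod, Finset.prod_congr rfl fun c' _ => hprod c',
    Finset.prod_mul_distrib, mul_assoc, ← Finset.prod_mul_distrib]
  congr 1
  refine Finset.prod_congr rfl fun c' hc' => ?_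
  rw [← pow_succ, Nat.sub_add_cancel (h.card_fib_pos hc')]

lemma exists_prod_fib_smul {c' : Fin n → K} {d : Fin ℓ → K} (hd : d ∈ fib D A' c')
    {η : ExtF K ℓ} (hη : IsLog A' η) :
    ∃ y, dP D.c0 * (dP d * η) = (∏ c ∈ fib D A' c', linP c) • y := by
  refine exists_prod_smul _ _ (fun c hc c₁ hc₁ hne =>
    A'.isRelPrime c (mem_fib.mp hc).1 c₁ (mem_fib.mp hc₁).1 hne) fun c hc => ?_
  obtain ⟨s, u, hs⟩ := exists_of_mem_fib hd hc
  obtain ⟨ζ, hζ⟩ := hη c (mem_fib.mp hc).1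
  refine ⟨(C s : PS K ℓ) • (dP D.c0 * ζ), ?_⟩
  rw [ι_mul_dP_mul hs, hζ, dP_mul_smul, smul_comm]

lemma dP_mul_pullF {c' : Fin n → K} (h : Triple D A A' B) (hc' : c' ∈ B.hyps)
    {η : ExtF K ℓ} (hη : IsLog A' η) :
    ∃ y, dP c' * pullF D.e η = linP c' ^ (fib D A' c').card • y := by
  obtain ⟨d, hd, t, ht, hdt⟩ := h.lift c' hc'
  have hdf : d ∈ fib D A' c' := mem_fib.mpr ⟨hd, t, ht, hdt⟩
  obtain ⟨y, hy⟩ := exists_prod_fib_smul hdf hη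
  obtain ⟨T, hT, hprod⟩ := pullP_prod_fib D A' c' (Finset.Subset.refl (fib D A' c'))
  have h1 := congrArg (fun z => pullF D.e (D.cv z)) hy
  simp only [D.cv_dα_mul, D.cv_smul, map_sub, map_mul, pullF_smul, D.pullF_dα, hprod, zero_mul,
    sub_zero, pullF_dP, hdt, dP_smul, smul_mul_assoc] at h1
  refine ⟨(C (t⁻¹ * T) : PS K n) • pullF D.e (D.cv y), smul_right_inj_ext (C_ne_zero.mpr ht) ?_⟩
  rw [h1, smul_smul, smul_smul]
  congr 1
  have hC : (C t : PS K n) * C t⁻¹ = 1 := by rw [← C_mul, mul_inv_cancel₀ ht, C_1]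
  rw [C_mul]
  linear_combination -(C T * linP c' ^ (fib D A' c').card) * hC

/-- The restriction to the hyperplane of a form logarithmic along `A'` is divisible by the
multiplicity polynomial. -/
lemma exists_pullF_eq_smul (h : Triple D A A' B) {b : PS K n} (hb : IsMultPoly D A' B b) {p : ℕ}
    {η : ExtF K ℓ} (hη : η ∈ Om A' p) : ∃ ζ ∈ Om B p, pullF D.e η = b • ζ := by
  have hlog := (mem_Om.mp hη).2
  obtain ⟨ζ, hζ⟩ : ∃ ζ, pullF D.e η = b • ζ := by
    refine hb.exists_smul fun c' hc' => ?_
    obtain ⟨y, hy⟩ := h.dP_mul_pullF hc' hlog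
    obtain ⟨z, hz⟩ := h.dP_mul_pullF hc' hlog.contract_X
    rw [pullF_ctr_X] at hz
    have h1 := ctr_dP_mul X c' (pullF D.e η)
    rw [hy, hz, map_smul, vf_X_cst, eq_sub_iff_add_eq, ← smul_add] at h1
    refine ⟨ctr (vf X) y + z, smul_right_inj_ext (linP_ne_zero (B.ne_zero c' hc')) ?_⟩
    rw [← h1, smul_smul, ← pow_succ', Nat.sub_add_cancel (h.card_fib_pos hc')]
  refine ⟨ζ, mem_Om.mpr ⟨mem_extP_of_smul_mem hb.ne_zero ?_, fun c' hc' => ?_⟩, hζ⟩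
  · rw [← hζ]
    exact pullF_mem _ (mem_Om.mp hη).1
  · obtain ⟨y, hy⟩ := h.dP_mul_pullF hc' hlog
    obtain ⟨b', hb', hrel⟩ := hb.factor hc'
    refine exists_smul_of_isRelPrime hrel ⟨y, ?_⟩
    refine smul_right_inj_ext (pow_ne_zero ((fib D A' c').card - 1)
      (linP_ne_zero (B.ne_zero c' hc'))) ?_
    rw [smul_smul, smul_smul, ← pow_succ, Nat.sub_add_cancel (h.card_fib_pos hc'), ← hy, ← hb', hζ,
      dP_mul_smul]

/-- A derivation logarithmic along `A'` evaluates `α` to a multiple of the multiplicity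
polynomial modulo `α`. -/
lemma dvd_pullP_vf (h : Triple D A A' B) {b : PS K n} (hb : IsMultPoly D A' B b)
    {ψ : Fin ℓ → PS K ℓ} (hψ : ∀ c ∈ A'.hyps, linP c ∣ vf ψ (cst c)) :
    b ∣ pullP D.e (vf ψ (cst D.c0)) := by
  refine hb.dvd fun c' hc' => ?_
  obtain ⟨d, hd, t, ht, hdt⟩ := h.lift c' hc'
  have hdf : d ∈ fib D A' c' := mem_fib.mpr ⟨hd, t, ht, hdt⟩
  obtain ⟨T, hT, hprod⟩ := pullP_prod_fib D A' c' (Finset.Subset.refl (fib D A' c'))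
  have h1 : (∏ c ∈ fib D A' c', linP c) ∣
      vf ψ (cst D.c0) * linP d - linP D.c0 * vf ψ (cst d) := by
    refine Finset.prod_dvd_of_isRelPrime (fun c hc c₁ hc₁ hne =>
      A'.isRelPrime c (mem_fib.mp hc).1 c₁ (mem_fib.mp hc₁).1 hne) fun c hc => ?_
    obtain ⟨s, u, hs⟩ := exists_of_mem_fib hdf hc
    obtain ⟨g, hg⟩ := hψ c (mem_fib.mp hc).1
    refine ⟨C s * (vf ψ (cst D.c0) - linP D.c0 * g), ?_⟩
    rw [hs, linP_add, linP_smul, linP_smul, cst_add, cst_smul, cst_smul, map_add, map_smul,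
      map_smul, hg, smul_eq_mul, smul_eq_mul]
    ring
  have h2 := map_dvd (pullP D.e) h1
  rw [hprod, map_sub, map_mul, map_mul, D.pullP_α, zero_mul, sub_zero, pullP_linP, hdt, linP_smul,
    (isUnit_C hT).mul_left_dvd, mul_left_comm, (isUnit_C ht).dvd_mul_left,
    ← Nat.sub_add_cancel (h.card_fib_pos hc'), pow_succ] at h2
  exact (mul_dvd_mul_iff_right (linP_ne_zero (B.ne_zero c' hc'))).mp h2

end Triple

/-- If `dα ∧ x` and `dα ∧ y` are divisible by `α`, then `x ∧ y` is divisible by `α` and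
`dα ∧ x ∧ y` is divisible by `α ^ 2`. -/
lemma exists_mul_eq_linP_smul {c : Fin ℓ → K} (hc : c ≠ 0) {p : ℕ} {x y : ExtF K ℓ}
    (hxp : x ∈ formsP K ℓ p) (hx : ∃ ζ, dP c * x = linP c • ζ) (hy : ∃ ζ, dP c * y = linP c • ζ) :
    (∃ z, x * y = linP c • z) ∧ ∃ z, dP c * (x * y) = linP c • linP c • z := by
  obtain ⟨ζ, hζ⟩ := hx
  have hζp : ζ ∈ formsP K ℓ (p + 1) := by
    refine mem_extP_of_smul_mem (linP_ne_zero hc) ?_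
    rw [← hζ]
    exact ι_mul_mem_extP _ hxp
  have hζ0 : dP c * ζ = 0 := by
    refine smul_right_inj_ext (linP_ne_zero hc) ?_
    rw [← dP_mul_smul, ← hζ, smul_zero]
    exact ι_mul_self_mul _ _
  obtain ⟨e, he, hr⟩ := exists_embedding hc
  obtain ⟨D, rfl, -⟩ := exists_hypData hc e he hr
  obtain ⟨a, b, hab⟩ := D.exists_form_decomp y
  rw [(D.pullF_eq_zero_iff y).mpr hy, map_zero, zero_add] at hab
  have hswap : ∀ {q : ℕ} {w : ExtF K ℓ}, w ∈ formsP K ℓ q →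
      w * y = linP D.c0 • (w * a) + (-1 : PS K ℓ) ^ q • (dP D.c0 * w * b) := by
    intro q w hw
    rw [hab, mul_add, mul_smul_comm, dP_eq, mul_ι_mul_of_mem_extP hw, mul_assoc]
  constructor
  · refine ⟨x * a + (-1 : PS K ℓ) ^ p • (ζ * b), ?_⟩
    rw [hswap hxp, hζ, smul_mul_assoc, smul_add, smul_comm (linP D.c0) ((-1 : PS K ℓ) ^ p)]
  · refine ⟨ζ * a, ?_⟩
    rw [← mul_assoc, hζ, smul_mul_assoc, hswap hζp, hζ0, zero_mul, smul_zero, add_zero]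

/-- Logarithmic forms are closed under the logarithmic wedge product. -/
lemma exists_mul_eq_Qa_smul {A : Arrangement K ℓ} {p q : ℕ} {x y : ExtF K ℓ} (hx : x ∈ Om A p)
    (hy : y ∈ Om A q) : ∃ z ∈ Om A (p + q), x * y = Qa A • z := by
  rw [mem_Om] at hx hy
  have hloc := fun c hc => exists_mul_eq_linP_smul (A.ne_zero c hc) hx.1 (hx.2 c hc) (hy.2 c hc)
  obtain ⟨z, hz⟩ := exists_prod_smul A.hyps linP A.isRelPrime fun c hc => (hloc c hc).1
  refine ⟨z, mem_Om.mpr ⟨mem_extP_of_smul_mem (Qa_ne_zero A) ?_, fun c hc => ?_⟩, hz⟩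
  · rw [Qa, ← hz]
    exact mul_mem_extP hx.1 hy.1
  · obtain ⟨w, hw⟩ := (hloc c hc).2
    have hrel : IsRelPrime (linP c) (∏ d ∈ A.hyps.erase c, linP d) :=
      IsRelPrime.prod_right fun d hd => A.isRelPrime c hc d (Finset.mem_of_mem_erase hd)
        (Finset.ne_of_mem_erase hd).symm
    refine exists_smul_of_isRelPrime hrel ⟨w, ?_⟩
    refine smul_right_inj_ext (linP_ne_zero (A.ne_zero c hc)) ?_
    rw [smul_smul, Finset.mul_prod_erase _ _ hc, ← dP_mul_smul, ← hz, hw]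

end Multiplicity

section DualBasis

variable {R R' P F : Type} [CommRing R] [CommRing R'] [AddCommGroup P] [Module R P]
  [AddCommGroup F] [Module R' F]

/-- A semilinear dual basis for the image of a semilinear map whose source and kernel are
projective. -/
lemma exists_semilinear_dual_basis {φ : R →+* R'} (hφ : Function.Surjective φ) {a : R}
    (hker : ∀ r, φ r = 0 ↔ ∃ s, r = a * s) (ha : ∀ r, a * r = 0 → r = 0) {d : ℕ}
    (hd : ∀ (X : Type) [AddCommGroup X] [Module R' X], pdLE R' d X) [Module.Finite R P]
    [Module.Projective R P] (g : P →ₛₗ[φ] F) (hk : Module.Projective R (LinearMap.ker g)) :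
    ∃ (m : ℕ) (x : Fin m → P) (Λ : Fin m → (P →ₗ[R] R)),
      (∀ y, g y = ∑ k, φ (Λ k y) • g (x k)) ∧ ∀ y, g y = 0 → ∀ k, φ (Λ k y) = 0 := by
  have : RingHomSurjective φ := ⟨hφ⟩
  let _ : Algebra R R' := φ.toAlgebra
  let _ : Module R (LinearMap.range g) := Module.compHom _ φ
  have hsc : IsScalarTower R R' (LinearMap.range g) :=
    ⟨fun r s x => by rw [Algebra.smul_def, mul_smul]; rfl⟩
  obtain ⟨G, hG⟩ : ∃ G : P →ₗ[R] LinearMap.range g, ∀ y, (G y : F) = g y :=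
    ⟨{ toFun := fun y => ⟨g y, y, rfl⟩
       map_add' := fun y z => Subtype.ext (map_add g y z)
       map_smul' := fun r y => Subtype.ext (g.map_smulₛₗ r y) }, fun _ => rfl⟩
  have hGs : Function.Surjective G := by
    rintro ⟨_, y, rfl⟩
    exact ⟨y, Subtype.ext (hG y)⟩
  have hG0 : ∀ y, G y = 0 ↔ g y = 0 := fun y => by rw [← hG, ZeroMemClass.coe_eq_zero]
  have hGker : pdLE R 0 (LinearMap.ker G) := by
    have e : LinearMap.ker g = LinearMap.ker G := by
      ext y
      rw [LinearMap.mem_ker, LinearMap.mem_ker, hG0]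
    rw [← e]
    exact hk
  have hE : pdLE R 1 (LinearMap.range g) :=
    pdLE.of_ker (M := P) (N := LinearMap.range g) hGs hGker (pdLE_of_projective 1)
  have hE' : Module.Projective R' (LinearMap.range g) :=
    pdLE_quotient (R := R) (R' := R') (p := 0) hφ hker ha hd hE
  have : Module.Finite R (LinearMap.range g) := Module.Finite.of_surjective G hGs
  have : Module.Finite R' (LinearMap.range g) := Module.Finite.of_restrictScalars_finite R _ _
  obtain ⟨m, q, s, hq, -, hqs⟩ := Module.Finite.exists_comp_eq_id_of_projective R' (LinearMap.range g)
  choose x hx using fun k : Fin m => hGs (q (Pi.single k 1))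
  have hlift : ∀ k : Fin m, ∃ Λ : P →ₗ[R] R, ∀ y, φ (Λ y) = s (G y) k := by
    intro k
    obtain ⟨Λ, hΛ⟩ := Module.projective_lifting_property (Algebra.linearMap R R')
      ((LinearMap.proj k ∘ₗ s).restrictScalars R ∘ₗ G) hφ
    exact ⟨Λ, fun y => LinearMap.congr_fun hΛ y⟩
  choose Λ hΛ using hlift
  refine ⟨m, x, Λ, fun y => ?_, fun y hy k => ?_⟩
  · have h1 : q (s (G y)) = G y := LinearMap.congr_fun hqs (G y)
    rw [pi_eq_sum_univ' (s (G y)), map_sum] at h1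
    have h2 := congrArg Subtype.val h1
    rw [hG] at h2
    rw [← h2, AddSubmonoidClass.coe_finsetSum]
    refine Finset.sum_congr rfl fun k _ => ?_
    rw [map_smul, hΛ, ← hG, hx]
    rfl
  · rw [hΛ, (hG0 y).mpr hy, map_zero]
    rfl

end DualBasis

section RestrictionBasis

variable {K : Type} [Field K] {n ℓ : ℕ}

instance finite_Om (A : Arrangement K ℓ) (p : ℕ) : Module.Finite (PS K ℓ) (Om A p) := by
  have hfg : (formsP K ℓ p).FG := by
    refine Submodule.FG.pow ?_ p
    rw [LinearMap.range_eq_map]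
    exact Module.Finite.fg_top.map _
  have : IsNoetherian (PS K ℓ) (formsP K ℓ p) := isNoetherian_of_fg_of_noetherian _ hfg
  have : IsNoetherian (PS K ℓ) (Om A p) :=
    isNoetherian_of_le (t := formsP K ℓ p) fun x hx => (mem_Om.mp hx).1
  infer_instance

lemma Qa_smul_mem_Om (A : Arrangement K ℓ) {p : ℕ} {η : ExtF K ℓ} (hη : η ∈ formsP K ℓ p) :
    Qa A • η ∈ Om A p := by
  refine mem_Om.mpr ⟨Submodule.smul_mem _ _ hη, fun c hc => ?_⟩
  refine ⟨(∏ d ∈ A.hyps.erase c, linP d) • (dP c * η), ?_⟩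
  rw [smul_smul, Finset.mul_prod_erase _ _ hc, dP_mul_smul, Qa]

lemma prod_erase_smul_dP_mem_Om (A : Arrangement K ℓ) (c : Fin ℓ → K) :
    (∏ d ∈ A.hyps.erase c, linP d) • dP c ∈ Om A 1 := by
  refine mem_Om.mpr ⟨Submodule.smul_mem _ _ (ι_mem_extP _), fun d hd => ?_⟩
  rcases eq_or_ne d c with rfl | hdc
  · refine ⟨0, ?_⟩
    rw [dP_mul_smul, show dP d * dP d = 0 from ExteriorAlgebra.ι_sq_zero _, smul_zero, smul_zero]
  · refine ⟨(∏ b ∈ (A.hyps.erase c).erase d, linP b) • (dP d * dP c), ?_⟩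
    rw [smul_smul, Finset.mul_prod_erase _ _ (Finset.mem_erase.mpr ⟨hdc, hd⟩), dP_mul_smul]

/-- The logarithmic form `Q η` for a polynomial one-form `η`. -/
def QaForm (A : Arrangement K ℓ) : (Fin ℓ → PS K ℓ) →ₗ[PS K ℓ] Om A 1 :=
  LinearMap.codRestrict _ (Qa A • ExteriorAlgebra.ι (PS K ℓ))
    fun g => Qa_smul_mem_Om A (ι_mem_extP g)

lemma coe_QaForm (A : Arrangement K ℓ) (g : Fin ℓ → PS K ℓ) :
    (QaForm A g : ExtF K ℓ) = Qa A • ExteriorAlgebra.ι _ g := rfl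

/-- The vector field dual to a functional on logarithmic one-forms. -/
def dualVf (A : Arrangement K ℓ) (Λ : Om A 1 →ₗ[PS K ℓ] PS K ℓ) : Fin ℓ → PS K ℓ :=
  fun j => Λ (QaForm A (Pi.single j 1))

lemma vf_dualVf (A : Arrangement K ℓ) (Λ : Om A 1 →ₗ[PS K ℓ] PS K ℓ) (g : Fin ℓ → PS K ℓ) :
    vf (dualVf A Λ) g = Λ (QaForm A g) := by
  rw [vf_apply]
  conv_rhs => rw [pi_eq_sum_univ' g, map_sum, map_sum]
  refine Finset.sum_congr rfl fun i _ => ?_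
  rw [map_smul, map_smul, smul_eq_mul, mul_comm]
  rfl

lemma linP_dvd_vf_dualVf (A : Arrangement K ℓ) (Λ : Om A 1 →ₗ[PS K ℓ] PS K ℓ) {c : Fin ℓ → K}
    (hc : c ∈ A.hyps) : linP c ∣ vf (dualVf A Λ) (cst c) := by
  refine ⟨Λ ⟨_, prod_erase_smul_dP_mem_Om A c⟩, ?_⟩
  rw [vf_dualVf, ← smul_eq_mul, ← map_smul]
  congr 1
  refine Subtype.ext ?_
  rw [coe_QaForm, SetLike.val_smul, smul_smul, Finset.mul_prod_erase _ _ hc]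
  rfl

lemma pdLE_PS (d : ℕ) (X : Type) [AddCommGroup X] [Module (PS K d) X] : pdLE (PS K d) d X :=
  pdLE_mvPolynomial K d X

namespace HypData
variable (D : HypData K n ℓ)

/-- Restriction of logarithmic forms to the hyperplane of `D`. -/
def resL (A : Arrangement K ℓ) (p : ℕ) :
    Om A p →ₛₗ[(pullP D.e : PS K ℓ →+* PS K n)] ExtF K n where
  toFun η := pullF D.e η
  map_add' _ _ := map_add _ _ _
  map_smul' _ _ := pullF_smul _ _ _

lemma resL_apply {A : Arrangement K ℓ} {p : ℕ} (η : Om A p) : D.resL A p η = pullF D.e η := rfl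

/-- The residue map on logarithmic forms. -/
def residueL (A : Arrangement K ℓ) (p : ℕ) :
    Om A p →ₛₗ[(pullP D.e : PS K ℓ →+* PS K n)] ExtF K n where
  toFun η := pullF D.e (D.cv η)
  map_add' x y := by rw [Submodule.coe_add, map_add, map_add]
  map_smul' r x := by rw [Submodule.coe_smul, D.cv_smul, pullF_smul]; rfl

lemma residueL_apply {A : Arrangement K ℓ} {p : ℕ} (η : Om A p) :
    D.residueL A p η = pullF D.e (D.cv η) := rfl

end HypData

namespace Triple
variable {D : HypData K n ℓ} {A A' : Arrangement K ℓ} {B : Arrangement K n}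

/-- Logarithmic forms along `A` are the kernel of the restriction map on those along `A'`. -/
lemma exists_kerRes_equiv (h : Triple D A A' B) (p : ℕ) :
    Nonempty (Om A p ≃ₗ[PS K ℓ] LinearMap.ker (D.resL A' p)) := by
  obtain ⟨f, hf⟩ : ∃ f : Om A p →ₗ[PS K ℓ] LinearMap.ker (D.resL A' p),
      ∀ η, (f η : ExtF K ℓ) = η := by
    refine ⟨LinearMap.codRestrict _ (Submodule.inclusion fun η hη => (h.mem_Om_iff_of_mem.mp hη).1)
      fun η => ?_, fun η => ?_⟩
    · rw [LinearMap.mem_ker, HypData.resL_apply, Submodule.coe_inclusion]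
      exact (h.mem_Om_iff_of_mem.mp η.2).2
    · rw [LinearMap.codRestrict_apply, Submodule.coe_inclusion]
  refine ⟨LinearEquiv.ofBijective f ⟨fun x y hxy => Subtype.ext ?_, ?_⟩⟩
  · rw [← hf, ← hf, hxy]
  · rintro ⟨⟨η, hη⟩, hr⟩
    rw [LinearMap.mem_ker, HypData.resL_apply] at hr
    exact ⟨⟨η, h.mem_Om_iff_of_mem.mpr ⟨hη, hr⟩⟩, Subtype.ext (Subtype.ext (hf _))⟩

lemma exists_kerResidue_equiv (h : Triple D A A' B) (p : ℕ) :
    Nonempty (Om A' p ≃ₗ[PS K ℓ] LinearMap.ker (D.residueL A p)) := by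
  obtain ⟨f, hf⟩ : ∃ f : Om A' p →ₗ[PS K ℓ] LinearMap.ker (D.residueL A p),
      ∀ η, (f η : ExtF K ℓ) = linP D.c0 • (η : ExtF K ℓ) := by
    refine ⟨
      { toFun := fun η => ⟨⟨linP D.c0 • η.1, h.α_smul_mem η.2⟩, ?_⟩
        map_add' := fun x y => Subtype.ext (Subtype.ext (smul_add _ _ _))
        map_smul' := fun r x => Subtype.ext (Subtype.ext (smul_comm _ _ _)) }, fun _ => rfl⟩
    rw [LinearMap.mem_ker, HypData.residueL_apply, D.cv_smul, pullF_smul, D.pullP_α, zero_smul]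
  refine ⟨LinearEquiv.ofBijective f ⟨fun x y hxy => Subtype.ext ?_, ?_⟩⟩
  · refine smul_right_inj_ext (linP_ne_zero h.c0_ne_zero) ?_
    rw [← hf, ← hf, hxy]
  · rintro ⟨⟨η, hη⟩, hr⟩
    obtain ⟨ζ, hζ, rfl⟩ := h.exists_α_smul hη hr
    exact ⟨⟨ζ, hζ⟩, Subtype.ext (Subtype.ext (hf _))⟩

/-- A dual basis for the restriction to `B` of the logarithmic one-forms along `A'`. -/
lemma exists_restriction_basis (h : Triple D A A' B) {b : PS K n} (hb : IsMultPoly D A' B b)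
    (hbQ : b * Qa B = pullP D.e (Qa A')) (hA' : Module.Projective (PS K ℓ) (Om A' 1))
    (hA : Module.Projective (PS K ℓ) (Om A 1)) :
    ∃ (m : ℕ) (ε θ : Fin m → Fin n → PS K n), (∀ k, ExteriorAlgebra.ι _ (ε k) ∈ Om B 1 ∧
      ∃ η ∈ Om A' 1, pullF D.e η = b • ExteriorAlgebra.ι _ (ε k)) ∧
      (∀ k, ∀ c ∈ B.hyps, linP c ∣ vf (θ k) (cst c)) ∧
      ∀ g, ∑ k, vf (θ k) g • ε k = Qa B • g := by
  obtain ⟨m, x, Λ, hx, hΛ⟩ := exists_semilinear_dual_basis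
    (φ := (pullP D.e : PS K ℓ →+* PS K n)) D.pullP_surjective D.pullP_eq_zero_iff
    (fun r hr => (mul_eq_zero.mp hr).resolve_left (linP_ne_zero h.c0_ne_zero)) (pdLE_PS n)
    (D.resL A' 1) (Module.Projective.of_equiv (h.exists_kerRes_equiv 1).some)
  have hε : ∀ k, ∃ ε, ExteriorAlgebra.ι _ ε ∈ Om B 1 ∧
      pullF D.e (x k) = b • ExteriorAlgebra.ι (PS K n) ε := by
    intro k
    obtain ⟨ζ, hζ, hxζ⟩ := h.exists_pullF_eq_smul hb (x k).2
    have hm := (mem_Om.mp hζ).1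
    rw [formsP, pow_one] at hm
    obtain ⟨ε, rfl⟩ := hm
    exact ⟨ε, hζ, hxζ⟩
  choose ε hεB hεx using hε
  have hφ : ∀ k g g', pullV D.e g = pullV D.e g' →
      pullP D.e (vf (dualVf A' (Λ k)) g) = pullP D.e (vf (dualVf A' (Λ k)) g') := by
    intro k g g' hg
    have h1 := hΛ (QaForm A' g - QaForm A' g') (by
      rw [map_sub, sub_eq_zero, HypData.resL_apply, HypData.resL_apply, coe_QaForm, coe_QaForm,
        pullF_smul, pullF_smul, pullF_ι, pullF_ι, hg]) k
    rw [map_sub, map_sub, sub_eq_zero, ← vf_dualVf, ← vf_dualVf] at h1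
    exact h1
  have hep : ∀ g, pullV D.e (pullV D.pr g) = g := fun g => by rw [pullV_comp, D.pr_e, pullV_id]
  set θ : Fin m → Fin n → PS K n := fun k i =>
    pullP D.e (vf (dualVf A' (Λ k)) (pullV D.pr (Pi.single i 1))) with hθ
  have hvf : ∀ k g, vf (θ k) g = pullP D.e (vf (dualVf A' (Λ k)) (pullV D.pr g)) := by
    intro k g
    rw [vf_apply]
    conv_rhs => rw [pi_eq_sum_univ' g, map_sum, map_sum, map_sum]
    refine Finset.sum_congr rfl fun i _ => ?_
    rw [LinearMap.map_smulₛₗ, map_smul, smul_eq_mul, map_mul, mul_comm]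
    congr 1
    exact (D.pullP_pullP_pr _).symm
  refine ⟨m, ε, θ, fun k => ⟨hεB k, x k, (x k).2, hεx k⟩, fun k c' hc' => ?_, fun g => ?_⟩
  · obtain ⟨c, hc, t, ht, hct⟩ := h.lift c' hc'
    have h1 := map_dvd (pullP D.e) (linP_dvd_vf_dualVf A' (Λ k) hc)
    rw [hφ k (cst c) (pullV D.pr (pullV D.e (cst c))) (hep _).symm, ← hvf, pullV_cst, pullP_linP,
      hct, linP_smul, cst_smul, map_smul, smul_eq_mul, (isUnit_C ht).mul_left_dvd,
      (isUnit_C ht).dvd_mul_left] at h1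
    exact h1
  · have h1 := hx (QaForm A' (pullV D.pr g))
    simp only [HypData.resL_apply, coe_QaForm, pullF_smul, pullF_ι, hep, ← hbQ, hεx] at h1
    have h2 : Qa B • ExteriorAlgebra.ι (PS K n) g =
        ∑ k, vf (θ k) g • ExteriorAlgebra.ι (PS K n) (ε k) := by
      refine smul_right_inj_ext hb.ne_zero ?_
      rw [smul_smul, h1, Finset.smul_sum]
      refine Finset.sum_congr rfl fun k _ => ?_
      rw [smul_comm, hvf, vf_dualVf]
      rfl
    refine (ExteriorAlgebra.ι_inj (PS K n) _ _).mp ?_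
    rw [map_sum, map_smul, h2]
    exact Finset.sum_congr rfl fun k _ => map_smul _ _ _

end Triple
end RestrictionBasis

section DivisibleContractions

variable {R : Type} [CommRing R] {m : ℕ}

lemma exists_divisible_projector (q : R) (l : List (Fin m)) :
    ∃ T : ExteriorAlgebra R (Fin m → R) →ₗ[R] ExteriorAlgebra R (Fin m → R),
      (∀ x, (∀ k, ∃ y, ctr (LinearMap.proj k) x = q • y) → ∃ y, T x = x + q • y) ∧
      (∀ j ∈ l, ∀ y, T (ExteriorAlgebra.ι R (Pi.single j 1 : Fin m → R) * y) = 0) ∧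
      ∀ j y, ∃ z, T (ExteriorAlgebra.ι R (Pi.single j 1 : Fin m → R) * y) =
        ExteriorAlgebra.ι R (Pi.single j 1 : Fin m → R) * z := by
  induction l with
  | nil => exact ⟨LinearMap.id, fun x _ => ⟨0, by simp⟩, by simp, fun j y => ⟨y, rfl⟩⟩
  | cons k l ih =>
    obtain ⟨T, h1, h2, h3⟩ := ih
    obtain ⟨S, hS⟩ : ∃ S : ExteriorAlgebra R (Fin m → R) →ₗ[R] ExteriorAlgebra R (Fin m → R),
        ∀ x, S x = x - ExteriorAlgebra.ι R (Pi.single k 1 : Fin m → R) * ctr (LinearMap.proj k) x :=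
      ⟨LinearMap.id - LinearMap.mulLeft R (ExteriorAlgebra.ι R (Pi.single k 1 : Fin m → R)) ∘ₗ
        ctr (LinearMap.proj k), fun _ => rfl⟩
    have hSk : ∀ z, S (ExteriorAlgebra.ι R (Pi.single k 1 : Fin m → R) * z) = 0 := by
      intro z
      rw [hS, ctr_ι_mul, mul_sub, ι_mul_self_mul, sub_zero, LinearMap.proj_apply, Pi.single_eq_same,
        one_smul, sub_self]
    refine ⟨S ∘ₗ T, fun x hx => ?_, fun j hj y => ?_, fun j y => ?_⟩
    · obtain ⟨y, hy⟩ := h1 x hx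
      obtain ⟨z, hz⟩ := hx k
      refine ⟨S y - ExteriorAlgebra.ι R (Pi.single k 1 : Fin m → R) * z, ?_⟩
      rw [LinearMap.comp_apply, hy, map_add, map_smul, hS x, hz, mul_smul_comm, smul_sub]
      abel
    · rw [LinearMap.comp_apply]
      rcases List.mem_cons.mp hj with rfl | hj
      · obtain ⟨z, hz⟩ := h3 j y
        rw [hz, hSk]
      · rw [h2 j hj, map_zero]
    · obtain ⟨z, hz⟩ := h3 j y
      rw [LinearMap.comp_apply, hz]
      rcases eq_or_ne k j with rfl | hkj
      · exact ⟨0, by rw [hSk, mul_zero]⟩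
      · refine ⟨z - ExteriorAlgebra.ι R (Pi.single k 1 : Fin m → R) * ctr (LinearMap.proj k) z, ?_⟩
        rw [hS, ctr_ι_mul, LinearMap.proj_apply, Pi.single_eq_of_ne hkj, zero_smul, zero_sub,
          mul_neg, ι_mul_swap, neg_neg, mul_sub]

/-- A form of positive degree is divisible by `q` as soon as its contractions are. -/
lemma exists_smul_of_contractions {q : R} {p : ℕ} {x : ExteriorAlgebra R (Fin m → R)}
    (hx : x ∈ extP R (Fin m → R) (p + 1))
    (h : ∀ k, ∃ y, ctr (LinearMap.proj k) x = q • y) : ∃ y, x = q • y := by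
  obtain ⟨T, h1, h2, -⟩ := exists_divisible_projector q (List.finRange m)
  have h0 : T x = 0 := by
    refine extP_induction (P := fun x => T x = 0) (fun x y hx hy => ?_) (fun v x _ => ?_) hx
    · rw [map_add, hx, hy, add_zero]
    · rw [pi_eq_sum_univ' v, map_sum, Finset.sum_mul, map_sum]
      refine Finset.sum_eq_zero fun i _ => ?_
      rw [map_smul, smul_mul_assoc, map_smul, h2 i (List.mem_finRange i), smul_zero]
  obtain ⟨y, hy⟩ := h1 x h
  refine ⟨-y, ?_⟩
  rw [smul_neg]
  exact eq_neg_of_add_eq_zero_left (hy.symm.trans h0)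

end DivisibleContractions

section RestrictionSurjective

variable {K : Type} [Field K] {n ℓ : ℕ}

lemma exists_eq_Qa_smul_of_mem_Om_zero {A : Arrangement K ℓ} {ν : ExtF K ℓ} (hν : ν ∈ Om A 0) :
    ∃ y, ν = Qa A • y := by
  rw [mem_Om] at hν
  obtain ⟨f, rfl⟩ := mem_extP_zero.mp hν.1
  refine exists_prod_smul A.hyps linP A.isRelPrime fun c hc => ?_
  obtain ⟨ζ, hζ⟩ := hν.2 c hc
  obtain ⟨e, he, hr⟩ := exists_embedding (A.ne_zero c hc)
  obtain ⟨D, rfl, -⟩ := exists_hypData (A.ne_zero c hc) e he hr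
  have h1 := congrArg D.cv hζ
  rw [D.cv_dα_mul, D.cv_smul, HypData.cv, ctr_algebraMap, mul_zero, sub_zero] at h1
  exact ⟨_, h1⟩

namespace Triple
variable {D : HypData K n ℓ} {A A' : Arrangement K ℓ} {B : Arrangement K n}

/-- The logarithmic form `ζ` along `B` lifts, up to the multiplicity polynomial, to a
logarithmic form along `A'`. -/
def IsLift (D : HypData K n ℓ) (A' : Arrangement K ℓ) (B : Arrangement K n) (b : PS K n) (p : ℕ)
    (ζ : ExtF K n) : Prop :=
  ζ ∈ Om B p ∧ ∃ η ∈ Om A' p, pullF D.e η = b • ζ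

lemma IsLift.add {b : PS K n} {p : ℕ} {x y : ExtF K n} (hx : IsLift D A' B b p x)
    (hy : IsLift D A' B b p y) : IsLift D A' B b p (x + y) := by
  obtain ⟨hx, η, hη, hηx⟩ := hx
  obtain ⟨hy, ξ, hξ, hξy⟩ := hy
  exact ⟨add_mem hx hy, η + ξ, add_mem hη hξ, by rw [map_add, hηx, hξy, smul_add]⟩

lemma IsLift.smul {b : PS K n} {p : ℕ} (f : PS K n) {x : ExtF K n} (hx : IsLift D A' B b p x) :
    IsLift D A' B b p (f • x) := by
  obtain ⟨hx, η, hη, hηx⟩ := hx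
  refine ⟨Submodule.smul_mem _ _ hx, pullP D.pr f • η, Submodule.smul_mem _ _ hη, ?_⟩
  rw [pullF_smul, D.pullP_pullP_pr, hηx, smul_comm]

lemma isLift_zero (D : HypData K n ℓ) (A' : Arrangement K ℓ) (B : Arrangement K n) (b : PS K n)
    (p : ℕ) : IsLift D A' B b p 0 :=
  ⟨zero_mem _, 0, zero_mem _, by rw [map_zero, smul_zero]⟩

lemma IsLift.sum {b : PS K n} {p m : ℕ} (x : Fin m → ExtF K n)
    (hx : ∀ k, IsLift D A' B b p (x k)) : IsLift D A' B b p (∑ k, x k) :=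
  Finset.sum_induction _ _ (fun _ _ => IsLift.add) (isLift_zero D A' B b p) fun k _ => hx k

lemma IsLift.exists_mul_eq {b : PS K n} (hb0 : b ≠ 0) (hbQ : b * Qa B = pullP D.e (Qa A'))
    {p q : ℕ} {x y : ExtF K n} (hx : IsLift D A' B b p x) (hy : IsLift D A' B b q y) :
    ∃ z, IsLift D A' B b (p + q) z ∧ x * y = Qa B • z := by
  obtain ⟨hx, η, hη, hηx⟩ := hx
  obtain ⟨hy, ξ, hξ, hξy⟩ := hy
  obtain ⟨z, hz, hxy⟩ := exists_mul_eq_Qa_smul hx hy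
  obtain ⟨ζ, hζ, hηξ⟩ := exists_mul_eq_Qa_smul hη hξ
  refine ⟨z, ⟨hz, ζ, hζ, ?_⟩, hxy⟩
  refine smul_right_inj_ext (mul_ne_zero hb0 (Qa_ne_zero B)) ?_
  rw [hbQ, ← pullF_smul, ← hηξ, map_mul, hηx, hξy, smul_mul_assoc, mul_smul_comm, hxy, ← hbQ,
    smul_smul, smul_smul, smul_smul]
  congr 1
  ring

/-- The restriction of logarithmic forms is surjective when `A` and `A'` are free. -/
lemma isLift_of_projective (h : Triple D A A' B) {b : PS K n} (hb : IsMultPoly D A' B b)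
    (hbQ : b * Qa B = pullP D.e (Qa A')) (hA' : Module.Projective (PS K ℓ) (Om A' 1))
    (hA : Module.Projective (PS K ℓ) (Om A 1)) {p : ℕ} {ν : ExtF K n} (hν : ν ∈ Om B p) :
    IsLift D A' B b p ν := by
  obtain ⟨m, ε, θ, hε, hθ, hεθ⟩ := h.exists_restriction_basis hb hbQ hA' hA
  obtain ⟨u, hu⟩ : ∃ u : (Fin n → PS K n) →ₗ[PS K n] (Fin m → PS K n),
      ∀ g k, u g k = vf (θ k) g := ⟨LinearMap.pi fun k => vf (θ k), fun _ _ => rfl⟩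
  obtain ⟨w, hw⟩ : ∃ w : (Fin m → PS K n) →ₗ[PS K n] (Fin n → PS K n),
      ∀ z, w z = ∑ k, z k • ε k :=
    ⟨Fintype.linearCombination (PS K n) ε, Fintype.linearCombination_apply (PS K n) ε⟩
  have hwu : ∀ g, w (u g) = Qa B • g := fun g => by simp only [hw, hu, hεθ]
  have hwu' : ∀ (p : ℕ) (x : ExtF K n), x ∈ formsP K n p →
      extMap (RingHom.id _) w (extMap (RingHom.id _) u x) = Qa B ^ p • x := by
    intro p
    induction p with
    | zero =>
      intro x hx
      obtain ⟨r, rfl⟩ := mem_extP_zero.mp hx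
      rw [extMap_algebraMap, extMap_algebraMap, pow_zero, one_smul]
      rfl
    | succ p ih =>
      intro x hx
      refine extP_induction (P := fun x => extMap (RingHom.id _) w (extMap (RingHom.id _) u x) =
        Qa B ^ (p + 1) • x) (fun x y hx hy => ?_) (fun v x hx => ?_) hx
      · rw [map_add, map_add, hx, hy, smul_add]
      · rw [map_mul, map_mul, extMap_ι, extMap_ι, ih x hx, hwu, map_smul, smul_mul_assoc,
          mul_smul_comm, smul_smul, pow_succ']
  have hdiv : ∀ (p : ℕ) (x : ExtF K n), x ∈ Om B p →
      ∃ y, extMap (RingHom.id _) u x = Qa B • y := by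
    intro p
    induction p with
    | zero =>
      intro x hx
      obtain ⟨y, rfl⟩ := exists_eq_Qa_smul_of_mem_Om_zero hx
      exact ⟨_, extMap_smul _ _ _ _⟩
    | succ p ih =>
      intro x hx
      rw [mem_Om] at hx
      refine exists_smul_of_contractions (extMap_mem_extP _ _ hx.1) fun k => ?_
      rw [← extMap_ctr (RingHom.id _) u (vf (θ k)) _ fun g => (hu g k).symm]
      exact ih _ (mem_Om.mpr ⟨ctr_mem_extP _ hx.1, hx.2.contract (hθ k)⟩)
  have hlift : ∀ (p : ℕ) (x : ExteriorAlgebra (PS K n) (Fin m → PS K n)),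
      x ∈ extP (PS K n) (Fin m → PS K n) p →
      ∃ ζ, IsLift D A' B b p ζ ∧ Qa B • extMap (RingHom.id _) w x = Qa B ^ p • ζ := by
    intro p
    induction p with
    | zero =>
      intro x hx
      obtain ⟨r, rfl⟩ := mem_extP_zero.mp hx
      refine ⟨r • Qa B • 1, ?_, ?_⟩
      · refine IsLift.smul r ⟨Qa_smul_mem_Om B (mem_extP_zero.mpr ⟨1, map_one _⟩), Qa A' • 1,
          Qa_smul_mem_Om A' (mem_extP_zero.mpr ⟨1, map_one _⟩), ?_⟩
        rw [pullF_smul, map_one, ← hbQ, mul_smul]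
      · rw [extMap_algebraMap, pow_zero, one_smul, smul_comm r, ← Algebra.algebraMap_eq_smul_one]
        rfl
    | succ p ih =>
      intro x hx
      refine extP_induction (P := fun x => ∃ ζ, IsLift D A' B b (p + 1) ζ ∧
        Qa B • extMap (RingHom.id _) w x = Qa B ^ (p + 1) • ζ) ?_ (fun v x hx => ?_) hx
      · rintro x y ⟨ζ, hζ, hx⟩ ⟨ξ, hξ, hy⟩
        exact ⟨ζ + ξ, hζ.add hξ, by rw [map_add, smul_add, hx, hy, smul_add]⟩
      · obtain ⟨ζ, hζ, hxζ⟩ := ih x hx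
        have hv : IsLift D A' B b 1 (ExteriorAlgebra.ι _ (w v)) := by
          rw [hw, map_sum]
          refine IsLift.sum _ fun k => ?_
          rw [map_smul]
          exact IsLift.smul _ (hε k)
        obtain ⟨z, hz, hvz⟩ := hv.exists_mul_eq hb.ne_zero hbQ hζ
        refine ⟨z, add_comm 1 p ▸ hz, ?_⟩
        rw [map_mul, extMap_ι, ← mul_smul_comm, hxζ, mul_smul_comm, hvz, smul_smul, pow_succ]
  obtain ⟨x, hx⟩ := hdiv p ν hν
  have hνp := (mem_Om.mp hν).1
  have hxp : x ∈ extP (PS K n) (Fin m → PS K n) p := by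
    refine mem_extP_of_smul_mem (Qa_ne_zero B) ?_
    rw [← hx]
    exact extMap_mem_extP _ _ hνp
  obtain ⟨ζ, hζ, hxζ⟩ := hlift p x hxp
  have h1 := hwu' p ν hνp
  rw [hx, extMap_smul, RingHom.id_apply, hxζ] at h1
  exact smul_right_inj_ext (pow_ne_zero p (Qa_ne_zero B)) h1 ▸ hζ

end Triple
end RestrictionSurjective

section ResidueSurjective

variable {K : Type} [Field K] {n ℓ : ℕ}

lemma vf_smul (f : PS K ℓ) (ψ g : Fin ℓ → PS K ℓ) : vf (f • ψ) g = f * vf ψ g := by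
  simp only [vf_apply, Pi.smul_apply, smul_eq_mul, mul_assoc, Finset.mul_sum]

namespace Triple
variable {D : HypData K n ℓ} {A A' : Arrangement K ℓ} {B : Arrangement K n}

lemma erase_hyps (h : Triple D A A' B) : A.hyps.erase D.c0 = A'.hyps := by
  ext c
  rw [Finset.mem_erase, h.mem_iff]
  constructor
  · rintro ⟨hne, rfl | hc⟩
    · exact absurd rfl hne
    · exact hc
  · intro hc
    exact ⟨fun hcc => h.notMem (hcc ▸ hc), Or.inr hc⟩

lemma Qa_eq (h : Triple D A A' B) : Qa A = linP D.c0 * Qa A' := by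
  rw [Qa, Qa, ← h.erase_hyps, Finset.mul_prod_erase _ _ ((h.mem_iff _).mpr (Or.inl rfl))]

/-- The constant function `Q(B)` is the residue of a logarithmic one-form along `A`. -/
lemma exists_residue_eq_Qa (h : Triple D A A' B) {b : PS K n} (hb : IsMultPoly D A' B b)
    (hbQ : b * Qa B = pullP D.e (Qa A')) (hA' : Module.Projective (PS K ℓ) (Om A' 1))
    (hA : Module.Projective (PS K ℓ) (Om A 1)) :
    ∃ ω ∈ Om A 1, pullF D.e (D.cv ω) = Qa B • 1 := by
  have hα := linP_ne_zero h.c0_ne_zero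
  obtain ⟨m, x, Λ, hx, hΛ⟩ := exists_semilinear_dual_basis
    (φ := (pullP D.e : PS K ℓ →+* PS K n)) D.pullP_surjective D.pullP_eq_zero_iff
    (fun r hr => (mul_eq_zero.mp hr).resolve_left hα) (pdLE_PS n)
    (D.residueL A 1) (Module.Projective.of_equiv (h.exists_kerResidue_equiv 1).some)
  have hθ : ∀ k i, ∃ f, dualVf A (Λ k) i = linP D.c0 * f := by
    intro k i
    refine (D.pullP_eq_zero_iff _).mp (hΛ (QaForm A (Pi.single i 1)) ?_ k)
    rw [HypData.residueL_apply, coe_QaForm, D.cv_smul, pullF_smul, h.Qa_eq, map_mul, D.pullP_α,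
      zero_mul, zero_smul]
  choose ψ hψ using hθ
  have hψ' : ∀ k, dualVf A (Λ k) = linP D.c0 • ψ k := fun k => funext fun i => hψ k i
  have hlog : ∀ k, ∀ c ∈ A'.hyps, linP c ∣ vf (ψ k) (cst c) := by
    intro k c hc
    have h1 := linP_dvd_vf_dualVf A (Λ k) ((h.mem_iff c).mpr (Or.inr hc))
    rw [hψ', vf_smul] at h1
    exact (h.isRelPrime_α c hc).dvd_of_dvd_mul_left h1
  choose f hf using fun k => h.dvd_pullP_vf hb (hlog k)
  obtain ⟨y, hy⟩ : ∃ y : Om A 1, (y : ExtF K ℓ) = Qa A' • dP D.c0 :=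
    ⟨⟨_, prod_erase_smul_dP_mem_Om A D.c0⟩, by simp only [h.erase_hyps, Qa]⟩
  have hΛy : ∀ k, Λ k y = vf (ψ k) (cst D.c0) := by
    intro k
    refine mul_left_cancel₀ hα ?_
    rw [← vf_smul, ← hψ', vf_dualVf, ← smul_eq_mul, ← map_smul]
    congr 1
    refine Subtype.ext ?_
    rw [Submodule.coe_smul, hy, coe_QaForm, smul_smul, h.Qa_eq, dP_eq]
  have hres : pullF D.e (D.cv y) = (b * Qa B) • 1 := by
    rw [hy, D.cv_smul, pullF_smul, hbQ, HypData.cv, dP_eq, ctr_ι, vf_cst_cst, D.dot_v, C_1,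
      map_one, map_one]
  refine ⟨∑ k, pullP D.pr (f k) • (x k : ExtF K ℓ),
    Submodule.sum_mem _ fun k _ => Submodule.smul_mem _ _ (x k).2, ?_⟩
  refine smul_right_inj_ext hb.ne_zero ?_
  rw [smul_smul, ← hres, ← HypData.residueL_apply, hx, map_sum, map_sum, Finset.smul_sum]
  refine Finset.sum_congr rfl fun k _ => ?_
  rw [D.cv_smul, pullF_smul, D.pullP_pullP_pr, smul_smul, ← hf, hΛy]
  rfl

/-- The residue map is surjective when `A` and `A'` are free. -/
lemma exists_residue_eq (h : Triple D A A' B) (hA' : Module.Projective (PS K ℓ) (Om A' 1))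
    (hA : Module.Projective (PS K ℓ) (Om A 1)) {p : ℕ} {ν : ExtF K n} (hν : ν ∈ Om B p) :
    ∃ ζ ∈ Om A (p + 1), pullF D.e (D.cv ζ) = ν := by
  obtain ⟨b, hb, hbQ⟩ := h.exists_isMultPoly
  obtain ⟨ω, hω, hres⟩ := h.exists_residue_eq_Qa hb hbQ hA' hA
  obtain ⟨-, τ, hτ, hτν⟩ := h.isLift_of_projective hb hbQ hA' hA hν
  have hω' := h.mem_Om_iff_of_mem.mp hω
  obtain ⟨ζ, hζ, hωτ⟩ := exists_mul_eq_Qa_smul hω'.1 hτ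
  have hQ : pullP D.e (Qa A') ≠ 0 := by
    rw [← hbQ]
    exact mul_ne_zero hb.ne_zero (Qa_ne_zero B)
  refine ⟨ζ, ?_, ?_⟩
  · rw [add_comm p 1, h.mem_Om_iff_of_mem]
    refine ⟨hζ, smul_right_inj_ext hQ ?_⟩
    rw [← pullF_smul, ← hωτ, map_mul, hω'.2, zero_mul, smul_zero]
  · refine smul_right_inj_ext hQ ?_
    have hm := (mem_Om.mp hω).1
    rw [formsP, pow_one] at hm
    obtain ⟨g, rfl⟩ := hm
    rw [HypData.cv, ctr_ι, pullF_algebraMap] at hres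
    rw [← pullF_smul, ← D.cv_smul, ← hωτ, HypData.cv, ctr_ι_mul, map_sub, pullF_smul, map_mul,
      hω'.2, zero_mul, sub_zero, hτν, Algebra.smul_def, hres, smul_mul_assoc, one_mul, smul_smul,
      mul_comm (Qa B), hbQ]

end Triple
end ResidueSurjective

section Localization

variable {K : Type} [Field K] {n ℓ : ℕ}

/-- The ideal-theoretic form of the statement that a family of products of linear forms has no
common zero apart from the origin. -/
lemma exists_pow_linP_mem {I : Ideal (PS K n)} (h : ∀ y : Fin n → K, y ≠ 0 → ∃ f ∈ I,
    ∀ q : Ideal (PS K n), q.IsPrime → f ∈ q → ∃ c : Fin n → K, ∑ i, c i * y i ≠ 0 ∧ linP c ∈ q)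
    (c : Fin n → K) : ∃ k : ℕ, linP c ^ k ∈ I := by
  rw [← Ideal.mem_radical_iff, Ideal.radical_eq_sInf, Submodule.mem_sInf]
  rintro q ⟨hIq, hq⟩
  obtain ⟨U, hU⟩ : ∃ U : Submodule K (Fin n → K), ∀ c, c ∈ U ↔ linP c ∈ q :=
    ⟨{ carrier := {c | linP c ∈ q}
       add_mem' := fun {a b} ha hb => by
        rw [Set.mem_ofPred_eq, linP_add]
        exact add_mem ha hb
       zero_mem' := by simp [linP]
       smul_mem' := fun t a ha => by
        rw [Set.mem_ofPred_eq, linP_smul]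
        exact Ideal.mul_mem_left q _ ha }, fun _ => Iff.rfl⟩
  rw [← hU]
  by_contra hc
  have hlt : U < ⊤ := lt_top_iff_ne_top.mpr fun hT => hc (hT ▸ Submodule.mem_top)
  obtain ⟨f, hf0, hf⟩ := U.exists_le_ker_of_lt_top hlt
  have hfd : ∀ d : Fin n → K, f d = ∑ i, d i * f (Pi.single i 1) := by
    intro d
    conv_lhs => rw [pi_eq_sum_univ' d, map_sum]
    exact Finset.sum_congr rfl fun i _ => map_smul _ _ _
  obtain ⟨g, hgI, hg⟩ := h (fun i => f (Pi.single i 1)) fun h0 => hf0 (LinearMap.ext fun d => by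
    rw [hfd, LinearMap.zero_apply]
    exact Finset.sum_eq_zero fun i _ => by rw [show f (Pi.single i 1) = 0 from congrFun h0 i, mul_zero])
  obtain ⟨d, hd, hdq⟩ := hg q hq (hIq hgI)
  exact hd (by rw [← hfd]; exact hf ((hU d).mpr hdq))

/-- The product of the defining forms of the hyperplanes of `A` not containing `x`. -/
def offP (A : Arrangement K ℓ) (x : Fin ℓ → K) : PS K ℓ :=
  ∏ c ∈ A.hyps.filter (fun c => ¬ ∑ i, c i * x i = 0), linP c

lemma Qa_locArr_mul_offP (A : Arrangement K ℓ) (x : Fin ℓ → K) :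
    Qa (locArr A x) * offP A x = Qa A :=
  Finset.prod_filter_mul_prod_filter_not _ _ _

lemma Om_le_locArr (A : Arrangement K ℓ) (x : Fin ℓ → K) {p : ℕ} {η : ExtF K ℓ} (hη : η ∈ Om A p) :
    η ∈ Om (locArr A x) p := by
  rw [mem_Om] at hη ⊢
  exact ⟨hη.1, fun c hc => hη.2 c (Finset.mem_filter.mp hc).1⟩

lemma offP_smul_mem_Om (A : Arrangement K ℓ) (x : Fin ℓ → K) {p : ℕ} {η : ExtF K ℓ}
    (hη : η ∈ Om (locArr A x) p) : offP A x • η ∈ Om A p := by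
  rw [mem_Om] at hη ⊢
  refine ⟨Submodule.smul_mem _ _ hη.1, fun c hc => ?_⟩
  by_cases hcx : ∑ i, c i * x i = 0
  · exact hη.2.smul _ c (Finset.mem_filter.mpr ⟨hc, hcx⟩)
  · obtain ⟨g, hg⟩ : linP c ∣ offP A x :=
      Finset.dvd_prod_of_mem _ (Finset.mem_filter.mpr ⟨hc, hcx⟩)
    exact ⟨g • (dP c * η), by rw [dP_mul_smul, hg, mul_smul]⟩

lemma exists_linP_mem_of_offP_mem {A : Arrangement K ℓ} {x : Fin ℓ → K} {q : Ideal (PS K ℓ)}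
    (hq : q.IsPrime) (h : offP A x ∈ q) : ∃ c : Fin ℓ → K, ∑ i, c i * x i ≠ 0 ∧ linP c ∈ q := by
  obtain ⟨c, hc, hcq⟩ := (Ideal.IsPrime.prod_mem_iff (hp := hq)).mp h
  exact ⟨c, (Finset.mem_filter.mp hc).2, hcq⟩

/-- `A_x` is locally free at every nonzero point of the hyperplane `c0`, in the form of a
projectivity statement. -/
lemma LocallyFreeAlong.projective {A : Arrangement K ℓ} {c0 : Fin ℓ → K}
    (h : LocallyFreeAlong A (fun _ => 1) c0) {x : Fin ℓ → K} (hx : x ≠ 0)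
    (hx0 : ∑ i, c0 i * x i = 0) : Module.Projective (PS K ℓ) (Om (locArr A x) 1) := by
  have : Module.Free (PS K ℓ) (Om (locArr A x) 1) := h x hx hx0
  infer_instance

namespace Triple
variable {D : HypData K n ℓ} {A A' : Arrangement K ℓ} {B : Arrangement K n}

lemma locArr (h : Triple D A A' B) (y : Fin n → K) :
    Triple D (locArr A (D.e y)) (locArr A' (D.e y)) (locArr B y) where
  mem_iff c := by
    simp only [_root_.locArr, Finset.mem_filter, h.mem_iff]
    constructor
    · rintro ⟨rfl | hc, hcy⟩
      · exact Or.inl rfl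
      · exact Or.inr ⟨hc, hcy⟩
    · rintro (rfl | ⟨hc, hcy⟩)
      · exact ⟨Or.inl rfl, D.dot_e y⟩
      · exact ⟨Or.inr hc, hcy⟩
  notMem hc := h.notMem (Finset.mem_filter.mp hc).1
  restr c hc := by
    obtain ⟨hc, hcy⟩ := Finset.mem_filter.mp hc
    obtain ⟨c', hc', t, ht, hct⟩ := h.restr c hc
    refine ⟨c', Finset.mem_filter.mpr ⟨hc', ?_⟩, t, ht, hct⟩
    have h1 := rowF_dot D.e c y
    rw [hcy, hct] at h1
    simp only [Pi.smul_apply, smul_eq_mul, mul_assoc, ← Finset.mul_sum] at h1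
    exact (mul_eq_zero.mp h1).resolve_left ht
  lift c' hc' := by
    obtain ⟨hc', hcy⟩ := Finset.mem_filter.mp hc'
    obtain ⟨c, hc, t, ht, hct⟩ := h.lift c' hc'
    refine ⟨c, Finset.mem_filter.mpr ⟨hc, ?_⟩, t, ht, hct⟩
    rw [← rowF_dot, hct]
    simp only [Pi.smul_apply, smul_eq_mul, mul_assoc, ← Finset.mul_sum]
    rw [hcy, mul_zero]

lemma pullP_X_mem {I : Ideal (PS K n)} (hI : ∀ c : Fin n → K, ∃ k : ℕ, linP c ^ k ∈ I) (j : Fin ℓ) :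
    ∃ k : ℕ, pullP D.e (X j ^ k) ∈ I := by
  obtain ⟨k, hk⟩ := hI (rowF D.e (Pi.single j 1))
  exact ⟨k, by rw [map_pow, ← linP_single, pullP_linP]; exact hk⟩

lemma e_ne_zero (D : HypData K n ℓ) {y : Fin n → K} (hy : y ≠ 0) : D.e y ≠ 0 := by
  intro h
  have h1 := LinearMap.congr_fun D.pr_e y
  rw [LinearMap.comp_apply, h, map_zero] at h1
  exact hy h1.symm

/-- The restriction of logarithmic forms is surjective up to powers of the coordinates. -/
lemma exists_pow_isLift (h : Triple D A A' B) {b : PS K n}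
    (hbQ : b * Qa B = pullP D.e (Qa A'))
    (hlf' : LocallyFreeAlong A' (fun _ => 1) D.c0) (hlf : LocallyFreeAlong A (fun _ => 1) D.c0)
    (p : ℕ) (j : Fin ℓ) :
    ∃ k : ℕ, ∀ ν ∈ Om B p, IsLift D A' B b p (pullP D.e (X j ^ k) • ν) := by
  obtain ⟨I, hI⟩ : ∃ I : Ideal (PS K n), ∀ r, r ∈ I ↔ ∀ ν ∈ Om B p, IsLift D A' B b p (r • ν) :=
    ⟨{ carrier := {r | ∀ ν ∈ Om B p, IsLift D A' B b p (r • ν)}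
       add_mem' := fun hr hs ν hν => by
        rw [add_smul]
        exact (hr ν hν).add (hs ν hν)
       zero_mem' := fun ν _ => by
        rw [zero_smul]
        exact isLift_zero D A' B b p
       smul_mem' := fun r s hs ν hν => by
        rw [smul_assoc]
        exact (hs ν hν).smul r }, fun _ => Iff.rfl⟩
  suffices hI' : ∀ c, ∃ k : ℕ, linP c ^ k ∈ I by
    obtain ⟨k, hk⟩ := pullP_X_mem (D := D) hI' j
    exact ⟨k, (hI _).mp hk⟩
  refine exists_pow_linP_mem fun y hy => ?_
  refine ⟨offP B y, (hI _).mpr fun ν hν => ⟨Submodule.smul_mem _ _ hν, ?_⟩,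
    fun q hq hfq => exists_linP_mem_of_offP_mem hq hfq⟩
  have hx := e_ne_zero D hy
  obtain ⟨b', hb', hbQ'⟩ := (h.locArr y).exists_isMultPoly
  obtain ⟨-, η, hη, hην⟩ := (h.locArr y).isLift_of_projective hb' hbQ'
    (hlf'.projective hx (D.dot_e y)) (hlf.projective hx (D.dot_e y)) (Om_le_locArr B y hν)
  refine ⟨_, offP_smul_mem_Om A' _ hη, ?_⟩
  rw [pullF_smul, hην, smul_smul, smul_smul]
  congr 1
  refine mul_left_cancel₀ (Qa_ne_zero (_root_.locArr B y)) ?_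
  have h1 := hbQ
  rw [← Qa_locArr_mul_offP B y, ← Qa_locArr_mul_offP A' (D.e y), map_mul, ← hbQ'] at h1
  linear_combination -h1

/-- The residue map is surjective up to powers of the coordinates. -/
lemma exists_pow_residue (h : Triple D A A' B)
    (hlf' : LocallyFreeAlong A' (fun _ => 1) D.c0) (hlf : LocallyFreeAlong A (fun _ => 1) D.c0)
    (p : ℕ) (j : Fin ℓ) :
    ∃ k : ℕ, ∀ ν ∈ Om B p, ∃ ζ ∈ Om A (p + 1), pullF D.e (D.cv ζ) = pullP D.e (X j ^ k) • ν := by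
  obtain ⟨I, hI⟩ : ∃ I : Ideal (PS K n), ∀ r, r ∈ I ↔
      ∀ ν ∈ Om B p, ∃ ζ ∈ Om A (p + 1), pullF D.e (D.cv ζ) = r • ν :=
    ⟨{ carrier := {r | ∀ ν ∈ Om B p, ∃ ζ ∈ Om A (p + 1), pullF D.e (D.cv ζ) = r • ν}
       add_mem' := fun hr hs ν hν => by
        obtain ⟨ζ, hζ, hr⟩ := hr ν hν
        obtain ⟨ξ, hξ, hs⟩ := hs ν hν
        exact ⟨ζ + ξ, add_mem hζ hξ, by rw [map_add, map_add, hr, hs, add_smul]⟩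
       zero_mem' := fun ν _ => ⟨0, zero_mem _, by rw [map_zero, map_zero, zero_smul]⟩
       smul_mem' := fun r s hs ν hν => by
        obtain ⟨ζ, hζ, hs⟩ := hs ν hν
        refine ⟨pullP D.pr r • ζ, Submodule.smul_mem _ _ hζ, ?_⟩
        rw [D.cv_smul, pullF_smul, D.pullP_pullP_pr, hs, smul_assoc] }, fun _ => Iff.rfl⟩
  suffices hI' : ∀ c, ∃ k : ℕ, linP c ^ k ∈ I by
    obtain ⟨k, hk⟩ := pullP_X_mem (D := D) hI' j
    exact ⟨k, (hI _).mp hk⟩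
  refine exists_pow_linP_mem fun y hy => ?_
  have hx := e_ne_zero D hy
  refine ⟨pullP D.e (offP A (D.e y)), (hI _).mpr fun ν hν => ?_, fun q hq hfq => ?_⟩
  · obtain ⟨ζ, hζ, hζν⟩ := (h.locArr y).exists_residue_eq
      (hlf'.projective hx (D.dot_e y)) (hlf.projective hx (D.dot_e y)) (Om_le_locArr B y hν)
    exact ⟨_, offP_smul_mem_Om A _ hζ, by rw [D.cv_smul, pullF_smul, hζν]⟩
  · obtain ⟨c, hc, hcq⟩ := exists_linP_mem_of_offP_mem
      (q := q.comap (pullP D.e)) (hq.comap _) hfq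
    refine ⟨rowF D.e c, by rwa [rowF_dot], ?_⟩
    rwa [Ideal.mem_comap, pullP_linP] at hcq

end Triple
end Localization

section Tameness

variable {K : Type} [Field K] {n ℓ : ℕ}

/-- Modules of logarithmic forms are second syzygies. -/
lemma pdLE_Om (A : Arrangement K ℓ) (p : ℕ) : pdLE (PS K ℓ) (ℓ - 2) (Om A p) := by
  have := free_exteriorAlgebra (R := PS K ℓ) (M := Fin ℓ → PS K ℓ)
  have : Module.Free (PS K ℓ) (formsP K ℓ p) :=
    exteriorPower.instFree (R := PS K ℓ) (M := Fin ℓ → PS K ℓ) (n := p)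
  obtain ⟨f, hf⟩ : ∃ f : (formsP K ℓ p × (A.hyps → ExtF K ℓ)) →ₗ[PS K ℓ] (A.hyps → ExtF K ℓ),
      ∀ x c, f x c = dP c.1 * x.1 - linP c.1 • x.2 c :=
    ⟨LinearMap.pi fun c =>
      LinearMap.mulLeft (PS K ℓ) (dP c.1) ∘ₗ (formsP K ℓ p).subtype ∘ₗ LinearMap.fst _ _ _ -
        linP c.1 • (LinearMap.proj c ∘ₗ LinearMap.snd _ _ _), fun _ _ => rfl⟩
  have hfz : ∀ x, f x = 0 ↔ ∀ c : A.hyps, dP c.1 * x.1 = linP c.1 • x.2 c := fun x => by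
    simp only [funext_iff, hf, Pi.zero_apply, sub_eq_zero]
  obtain ⟨g, hg⟩ : ∃ g : LinearMap.ker f →ₗ[PS K ℓ] Om A p, ∀ x, (g x : ExtF K ℓ) = x.1.1 := by
    refine ⟨LinearMap.codRestrict _
      ((formsP K ℓ p).subtype ∘ₗ LinearMap.fst _ _ _ ∘ₗ (LinearMap.ker f).subtype) fun x => ?_,
      fun _ => rfl⟩
    exact mem_Om.mpr ⟨x.1.1.2, fun c hc => ⟨_, (hfz x.1).mp x.2 ⟨c, hc⟩⟩⟩
  refine (pdLE_ker_of_globalDimension (fun X => pdLE_PS ℓ X) f).of_linearEquiv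
    (LinearEquiv.ofBijective g ⟨?_, ?_⟩)
  · rintro ⟨⟨η, ζ⟩, hx⟩ ⟨⟨η', ζ'⟩, hx'⟩ hxy
    have h1 : η = η' := by
      have := congrArg Subtype.val hxy
      rw [hg, hg] at this
      exact Subtype.ext this
    subst h1
    refine Subtype.ext (Prod.ext rfl (funext fun c => ?_))
    refine smul_right_inj_ext (linP_ne_zero (A.ne_zero c.1 c.2)) ?_
    rw [← (hfz _).mp hx c, ← (hfz _).mp hx' c]
  · rintro ⟨η, hη⟩
    obtain ⟨hη', hl⟩ := mem_Om.mp hη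
    choose ζ hζ using fun c : A.hyps => hl c.1 c.2
    exact ⟨⟨(⟨η, hη'⟩, ζ), (hfz _).mpr hζ⟩, Subtype.ext (hg _)⟩

lemma projective_Om_zero (A : Arrangement K ℓ) : Module.Projective (PS K ℓ) (Om A 0) := by
  obtain ⟨g, hg⟩ : ∃ g : PS K ℓ →ₗ[PS K ℓ] Om A 0,
      ∀ r, (g r : ExtF K ℓ) = Qa A • algebraMap _ (ExtF K ℓ) r :=
    ⟨LinearMap.codRestrict _ (Qa A • Algebra.linearMap (PS K ℓ) (ExtF K ℓ)) fun r =>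
      Qa_smul_mem_Om A (mem_extP_zero.mpr ⟨r, rfl⟩), fun _ => rfl⟩
  refine Module.Projective.of_equiv (LinearEquiv.ofBijective g ⟨fun r s hrs => ?_, ?_⟩)
  · have h1 := congrArg Subtype.val hrs
    rw [hg, hg] at h1
    exact ExteriorAlgebra.algebraMap_leftInverse _ |>.injective
      (smul_right_inj_ext (Qa_ne_zero A) h1)
  · rintro ⟨ν, hν⟩
    obtain ⟨y, rfl⟩ := exists_eq_Qa_smul_of_mem_Om_zero hν
    obtain ⟨r, rfl⟩ : ∃ r, algebraMap _ (ExtF K ℓ) r = y :=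
      mem_extP_zero.mp (mem_extP_of_smul_mem (Qa_ne_zero A) (mem_Om.mp hν).1)
    exact ⟨r, Subtype.ext (hg r)⟩

lemma HypData.exists_pullP_X_ne_zero (D : HypData K n ℓ) (hn : 0 < n) :
    ∃ j, pullP D.e (X j) ≠ 0 := by
  by_contra! h
  have h1 : pullP D.e (pullP D.pr (linP (Pi.single (⟨0, hn⟩ : Fin n) 1))) = 0 := by
    rw [pullP_linP, linP, map_sum]
    exact Finset.sum_eq_zero fun i _ => by rw [map_mul, h, mul_zero]
  rw [D.pullP_pullP_pr, linP_single] at h1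
  exact X_ne_zero _ h1

/-- Comparison of projective dimensions along a map of modules of logarithmic forms which is
surjective away from the origin. -/
lemma HypData.pdLE_of_exists_pow (D : HypData K n ℓ) (hc : D.c0 ≠ 0) {M F : Type} [AddCommGroup M]
    [Module (PS K ℓ) M] [AddCommGroup F] [Module (PS K n) F] [Module.IsTorsionFree (PS K n) F]
    (N : Submodule (PS K n) F) {b : PS K n} (hb : b ≠ 0)
    (G : M →ₛₗ[(pullP D.e : PS K ℓ →+* PS K n)] F) (hG : ∀ y, ∃ ν ∈ N, G y = b • ν) {q : ℕ}
    (hn : 0 < n) (hq : q + 3 ≤ ℓ) (hP : pdLE (PS K ℓ) q (LinearMap.ker G))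
    (hM : pdLE (PS K ℓ) (ℓ - 2) M)
    (hC : ∀ j, ∃ k : ℕ, ∀ ν ∈ N, ∃ y, G y = b • pullP D.e (X j ^ k) • ν) :
    (pdLE (PS K ℓ) (q + 1) M → pdLE (PS K n) q N) ∧
      ∀ r, r + 1 ≤ q → pdLE (PS K n) r N → pdLE (PS K ℓ) q M := by
  let φ : PS K ℓ →+* PS K n := pullP D.e
  let _ : Algebra (PS K ℓ) (PS K n) := φ.toAlgebra
  let _ : Module (PS K ℓ) N := Module.compHom _ φ
  have hsc : IsScalarTower (PS K ℓ) (PS K n) N :=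
    ⟨fun r s x => by rw [Algebra.smul_def, mul_smul]; rfl⟩
  have hsm : ∀ (r : PS K ℓ) (x : N), r • x = pullP D.e r • x := fun _ _ => rfl
  have hsurj : Function.Surjective (algebraMap (PS K ℓ) (PS K n)) := D.pullP_surjective
  have hker : ∀ r, algebraMap (PS K ℓ) (PS K n) r = 0 ↔ ∃ s, r = linP D.c0 * s :=
    D.pullP_eq_zero_iff
  have ha : ∀ r, linP D.c0 * r = 0 → r = 0 :=
    fun r hr => (mul_eq_zero.mp hr).resolve_left (linP_ne_zero hc)
  have hbi : ∀ x y : N, b • (x : F) = b • (y : F) → x = y :=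
    fun x y h => Subtype.ext (smul_right_injective F hb h)
  choose T hTN hT using hG
  obtain ⟨g, hg⟩ : ∃ g : M →ₗ[PS K ℓ] N, ∀ y, b • (g y : F) = G y :=
    ⟨{ toFun := fun y => ⟨T y, hTN y⟩
       map_add' := fun y z => hbi _ _ (by
        rw [Submodule.coe_add, smul_add, ← hT, ← hT, ← hT, map_add])
       map_smul' := fun r y => hbi _ _ (by
        rw [RingHom.id_apply, hsm, Submodule.coe_smul, smul_comm, ← hT, ← hT, LinearMap.map_smulₛₗ]
        rfl) }, fun y => (hT y).symm⟩
  have hg0 : ∀ y, g y = 0 ↔ G y = 0 := by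
    intro y
    rw [← hg, smul_eq_zero_iff_right hb, ZeroMemClass.coe_eq_zero]
  have hP' : pdLE (PS K ℓ) q (LinearMap.ker g) := by
    have e : LinearMap.ker G = LinearMap.ker g := by
      ext y
      rw [LinearMap.mem_ker, LinearMap.mem_ker, hg0]
    rwa [← e]
  have hgs : Function.Surjective g := by
    refine surjective_of_pdLE (LinearMap.ker g).subtype g Subtype.val_injective
      (LinearMap.exact_subtype_ker_map g) hq hP' hM ?_ fun j => ?_
    · obtain ⟨j, hj⟩ := D.exists_pullP_X_ne_zero hn
      exact ⟨j, fun x y hxy => Subtype.ext (smul_right_injective F hj (congrArg Subtype.val hxy))⟩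
    · obtain ⟨k, hk⟩ := hC j
      refine ⟨k, fun ν => ?_⟩
      obtain ⟨y, hy⟩ := hk ν.1 ν.2
      exact ⟨y, hbi _ _ (by rw [hg, hy, hsm]; rfl)⟩
  refine ⟨fun h => ?_, fun r hr h => ?_⟩
  · exact pdLE_quotient (R := PS K ℓ) (R' := PS K n) hsurj hker ha (pdLE_PS n)
      (pdLE.of_ker (M := M) (N := N) hgs hP' h)
  · exact pdLE.middle (f := (LinearMap.ker g).subtype) (g := g) Subtype.val_injective hgs
      (LinearMap.exact_subtype_ker_map g) hP'
      ((pdLE.restrictScalars (R := PS K ℓ) (R' := PS K n) (N := N) hsurj hker ha h).mono hr)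

namespace Triple
variable {D : HypData K n ℓ} {A A' : Arrangement K ℓ} {B : Arrangement K n}

/-- Tameness of a deletion implies tameness of the arrangement and of its restriction. -/
theorem pdLE_Om (h : Triple D A A' B) (hn : ℓ = n + 1)
    (hlf' : LocallyFreeAlong A' (fun _ => 1) D.c0) (hlf : LocallyFreeAlong A (fun _ => 1) D.c0)
    (hA' : Tame A') (p : ℕ) : pdLE (PS K ℓ) p (Om A p) ∧ pdLE (PS K n) p (Om B p) := by
  have := isTorsionFree_exteriorAlgebra (R := PS K n) (M := Fin n → PS K n)
  have hB : ∀ p, pdLE (PS K ℓ) p (Om A p) → pdLE (PS K n) p (Om B p) := by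
    intro p hp
    by_cases hpn : n - 2 ≤ p
    · exact (_root_.pdLE_Om B p).mono hpn
    obtain ⟨b, hb, hbQ⟩ := h.exists_isMultPoly
    refine (D.pdLE_of_exists_pow h.c0_ne_zero (Om B p) hb.ne_zero (D.resL A' p)
      (fun y => h.exists_pullF_eq_smul hb y.2) (q := p) (by omega) (by omega)
      (hp.of_linearEquiv (h.exists_kerRes_equiv p).some) (_root_.pdLE_Om A' p) fun j => ?_).1
      ((hA' p (by omega)).mono (by omega))
    obtain ⟨k, hk⟩ := h.exists_pow_isLift hbQ hlf' hlf p j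
    refine ⟨k, fun ν hν => ?_⟩
    obtain ⟨-, η, hη, hην⟩ := hk ν hν
    exact ⟨⟨η, hη⟩, hην⟩
  suffices hA : pdLE (PS K ℓ) p (Om A p) from ⟨hA, hB p hA⟩
  induction p with
  | zero => exact projective_Om_zero A
  | succ p ih =>
    by_cases hpn : ℓ - 2 ≤ p + 1
    · exact (_root_.pdLE_Om A (p + 1)).mono hpn
    refine (D.pdLE_of_exists_pow h.c0_ne_zero (Om B p) one_ne_zero (D.residueL A (p + 1))
      (fun y => ⟨_, h.res_mem y.2, (one_smul _ _).symm⟩) (q := p + 1) (by omega) (by omega)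
      ((hA' (p + 1) (by omega)).of_linearEquiv (h.exists_kerResidue_equiv (p + 1)).some)
      (_root_.pdLE_Om A (p + 1)) fun j => ?_).2 p le_rfl (hB p ih)
    obtain ⟨k, hk⟩ := h.exists_pow_residue hlf' hlf p j
    refine ⟨k, fun ν hν => ?_⟩
    obtain ⟨ζ, hζ, hζν⟩ := hk ν hν
    exact ⟨⟨ζ, hζ⟩, by rw [HypData.residueL_apply, hζν, one_smul]⟩

end Triple

/-- The restriction of an arrangement to a hyperplane. -/
lemma exists_triple (D : HypData K n ℓ) {A A' : Arrangement K ℓ}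
    (hA : ∀ c, c ∈ A.hyps ↔ c = D.c0 ∨ c ∈ A'.hyps) (hA' : D.c0 ∉ A'.hyps) :
    ∃ B : Arrangement K n, Triple D A A' B := by
  have hne : ∀ c ∈ A'.hyps, rowF D.e c ≠ 0 := by
    intro c hc h0
    obtain ⟨t, ht⟩ := D.eq_add_smul_of_rowF_eq (h0.trans D.rowF_c0.symm)
    refine A.nonprop c ((hA c).mpr (Or.inr hc)) D.c0 ((hA _).mpr (Or.inl rfl))
      (fun h => hA' (h ▸ hc)) (1 + t) ?_
    rw [ht, add_smul, one_smul]
  let r : Setoid (Fin n → K) :=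
    { r := fun c c' => ∃ t : K, t ≠ 0 ∧ c = t • c'
      iseqv := ⟨fun c => ⟨1, one_ne_zero, (one_smul _ _).symm⟩,
        fun {c c'} ⟨t, ht, h⟩ => ⟨t⁻¹, inv_ne_zero ht, by rw [h, inv_smul_smul₀ ht]⟩,
        fun {a b c} ⟨t, ht, h⟩ ⟨u, hu, h'⟩ => ⟨t * u, mul_ne_zero ht hu, by rw [h, h', mul_smul]⟩⟩ }
  let ρ : (Fin n → K) → (Fin n → K) := fun c => (Quotient.mk r c).out
  have hρ : ∀ c, ∃ t : K, t ≠ 0 ∧ ρ c = t • c := fun c => Quotient.mk_out (s := r) c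
  have hρ' : ∀ c, ∃ t : K, t ≠ 0 ∧ c = t • ρ c := fun c => r.symm (hρ c)
  refine ⟨⟨A'.hyps.image fun c => ρ (rowF D.e c), ?_, ?_⟩, hA, hA', ?_, ?_⟩
  · intro c' hc' h0
    obtain ⟨c, hc, rfl⟩ := Finset.mem_image.mp hc'
    obtain ⟨t, -, ht⟩ := hρ' (rowF D.e c)
    exact hne c hc (by rw [ht, h0, smul_zero])
  · intro c' hc' d' hd' hcd t ht
    obtain ⟨c, hc, rfl⟩ := Finset.mem_image.mp hc'
    obtain ⟨d, hd, rfl⟩ := Finset.mem_image.mp hd'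
    refine hcd (congrArg Quotient.out (Quotient.sound ?_))
    have ht0 : t ≠ 0 := by
      rintro rfl
      obtain ⟨u, -, hu⟩ := hρ' (rowF D.e c)
      exact hne c hc (by rw [hu, ht, zero_smul, smul_zero])
    exact r.trans (hρ' _) (r.trans ⟨t, ht0, ht⟩ (hρ _))
  · exact fun c hc => ⟨_, Finset.mem_image_of_mem _ hc, hρ' _⟩
  · intro c' hc'
    obtain ⟨c, hc, rfl⟩ := Finset.mem_image.mp hc'
    exact ⟨c, hc, hρ' _⟩

end Tameness

/-- **Addition theorem for tameness I.**  If `A' = A ∖ {H}` is tame and both `A'` and `A`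
are locally free along `H`, then both `A` and the restriction `A^H` are tame. -/
theorem addition_theorem_for_tameness_I
    {K : Type} [Field K] {ℓ : ℕ} (A : Arrangement K ℓ) (hess : Essential A)
    (c0 : Fin ℓ → K) (hc0 : c0 ∈ A.hyps)
    (hdel_tame : Tame (delArr A c0))
    (hlf' : LocallyFreeAlong (delArr A c0) (fun _ => 1) c0)
    (hlf : LocallyFreeAlong A (fun _ => 1) c0) :
    Tame A ∧
      ∀ (e : (Fin (ℓ - 1) → K) →ₗ[K] (Fin ℓ → K)) (B : Arrangement K (ℓ - 1)),
        IsHypEmbedding c0 e → IsRestrictionOf B A c0 e → Tame B := by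
  have hmem : ∀ c, c ∈ A.hyps ↔ c = c0 ∨ c ∈ (delArr A c0).hyps := fun c => by
    rw [delArr, Finset.mem_erase]
    exact ⟨fun h => or_iff_not_imp_left.mpr fun hc => ⟨hc, h⟩,
      fun h => h.elim (fun hc => hc ▸ hc0) And.right⟩
  have hnot : c0 ∉ (delArr A c0).hyps := Finset.notMem_erase _ _
  have hc : c0 ≠ 0 := A.ne_zero c0 hc0
  have hℓ : ℓ = ℓ - 1 + 1 := by
    rcases ℓ with _ | ℓ
    · exact absurd (Subsingleton.elim c0 0) hc
    · rfl
  constructor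
  · obtain ⟨e, he, hr⟩ := exists_embedding hc
    obtain ⟨D, rfl, rfl⟩ := exists_hypData hc e he hr
    obtain ⟨B, h⟩ := exists_triple D hmem hnot
    exact fun p _ => (h.pdLE_Om hℓ hlf' hlf hdel_tame p).1
  · intro e B he hB
    obtain ⟨D, rfl, rfl⟩ := exists_hypData hc e he.1 he.2
    have h : Triple D A (delArr A D.c0) B :=
      { mem_iff := hmem
        notMem := hnot
        restr := fun c hc => hB.1 c (Finset.mem_of_mem_erase hc) (Finset.ne_of_mem_erase hc)
        lift := fun c' hc' => by
          obtain ⟨c, hc, hne, ht⟩ := hB.2 c' hc'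
          exact ⟨c, Finset.mem_erase.mpr ⟨hne, hc⟩, ht⟩ }
    exact fun p _ => (h.pdLE_Om hℓ hlf' hlf hdel_tame p).2
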